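/- Under the standing hypotheses on H, for each c ∈ ℝ the Hamilton–Jacobi equation ∂_θ u + H(θ,x,c+∂_x u) = a admits a viscosity solution u : 𝕋 × 𝕋 → ℝ (1-periodic in time) if and only if a = α(c), where α is the function of Mather such that u + tα(c) is bounded for every viscosity solution u of ∂_t u + H(t,x,c+∂_x u) = 0 on [t₀,∞) × 𝕋. In particular, for each c there is exactly one value of a for which a 1-periodic viscosity solution exists. -/

import Mathlib

open MeasureTheory Filter Set Topology

noncomputable section

/-- The Hamiltonian vector field `X(t,x,p) = (∂_p H, -∂_x H)` on `𝕋 × ℝ` (lifted to `ℝ × ℝ`). -/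
def HamVF (H : ℝ → ℝ → ℝ → ℝ) (t : ℝ) (z : ℝ × ℝ) : ℝ × ℝ :=
  (deriv (fun p => H t z.1 p) z.2, - deriv (fun x => H t x z.2) z.1)

/-- The standing hypotheses on the Hamiltonian `H`, with the circle `𝕋 = ℝ/ℤ` modelled by
`1`-periodicity in the space variable `x`. -/
structure BurgersHyp (H : ℝ → ℝ → ℝ → ℝ) : Prop where
  smooth : ContDiff ℝ 2 (fun q : ℝ × ℝ × ℝ => H q.1 q.2.1 q.2.2)
  per_t : ∀ t x p, H (t + 1) x p = H t x p
  per_x : ∀ t x p, H t (x + 1) p = H t x p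
  convexp : ∀ t x p, 0 < iteratedDeriv 2 (fun q => H t x q) p
  superlinear : ∀ t x, Tendsto (fun p => H t x p / |p|) (Bornology.cobounded ℝ) atTop
  complete : ∀ t₀ : ℝ, ∀ z₀ : ℝ × ℝ,
    ∃ γ : ℝ → ℝ × ℝ, γ t₀ = z₀ ∧ ∀ t, HasDerivAt γ (HamVF H t (γ t)) t

/-- The Lagrangian associated to `H` by Legendre duality. -/
def Lag (H : ℝ → ℝ → ℝ → ℝ) (t x v : ℝ) : ℝ := sSup (range fun p => p * v - H t x p)

/-- `ξ` is absolutely continuous on `[a,b]` with (a.e.) derivative `g`. -/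
def IsAC (ξ g : ℝ → ℝ) (a b : ℝ) : Prop :=
  IntervalIntegrable g volume a b ∧ ∀ t ∈ Icc a b, ξ t = ξ a + ∫ s in a..t, g s

/-- The set of values over which the Hopf–Lax–Oleinik infimum is taken. -/
def hloSet (H : ℝ → ℝ → ℝ → ℝ) (c a b : ℝ) (u : ℝ → ℝ) (x : ℝ) : Set ℝ :=
  {v | ∃ ξ g : ℝ → ℝ, IsAC ξ g a b ∧ ξ b = x ∧
    IntervalIntegrable (fun s => Lag H s (ξ s) (g s) - c * g s) volume a b ∧
    v = u (ξ a) + ∫ s in a..b, (Lag H s (ξ s) (g s) - c * g s)}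

/-- The Hopf–Lax–Oleinik operator `V^c_{a,b}`. -/
def hlo (H : ℝ → ℝ → ℝ → ℝ) (c a b : ℝ) (u : ℝ → ℝ) (x : ℝ) : ℝ := sInf (hloSet H c a b u x)

/-- Viscosity subsolution of `∂_t u + H(t,x,c+∂_x u) = a` on `D`. -/
def ViscSubSol (H : ℝ → ℝ → ℝ → ℝ) (c a : ℝ) (D : Set (ℝ × ℝ)) (u : ℝ → ℝ → ℝ) : Prop :=
  ∀ φ : ℝ × ℝ → ℝ, ContDiff ℝ 1 φ → ∀ z ∈ D,
    IsLocalMax (fun w : ℝ × ℝ => u w.1 w.2 - φ w) z →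
    fderiv ℝ φ z (1, 0) + H z.1 z.2 (c + fderiv ℝ φ z (0, 1)) ≤ a

/-- Viscosity supersolution of `∂_t u + H(t,x,c+∂_x u) = a` on `D`. -/
def ViscSuperSol (H : ℝ → ℝ → ℝ → ℝ) (c a : ℝ) (D : Set (ℝ × ℝ)) (u : ℝ → ℝ → ℝ) : Prop :=
  ∀ φ : ℝ × ℝ → ℝ, ContDiff ℝ 1 φ → ∀ z ∈ D,
    IsLocalMin (fun w : ℝ × ℝ => u w.1 w.2 - φ w) z →
    a ≤ fderiv ℝ φ z (1, 0) + H z.1 z.2 (c + fderiv ℝ φ z (0, 1))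

/-- Viscosity solution (Crandall–Lions) of `∂_t u + H(t,x,c+∂_x u) = a` on `D`. -/
def ViscSol (H : ℝ → ℝ → ℝ → ℝ) (c a : ℝ) (D : Set (ℝ × ℝ)) (u : ℝ → ℝ → ℝ) : Prop :=
  ViscSubSol H c a D u ∧ ViscSuperSol H c a D u

/-- Viscosity solution of `(HJc)` on `[t₀,∞) × 𝕋`: continuous up to `t₀`, `1`-periodic in `x`,
and a viscosity solution for `t > t₀`. -/
def IsViscSolOn (H : ℝ → ℝ → ℝ → ℝ) (c t₀ : ℝ) (u : ℝ → ℝ → ℝ) : Prop :=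
  ContinuousOn (fun z : ℝ × ℝ => u z.1 z.2) (Ici t₀ ×ˢ univ) ∧
  (∀ t x, u t (x + 1) = u t x) ∧
  ViscSol H c 0 (Ioi t₀ ×ˢ univ) u

/-- `w` is `K`-semi-concave: `∂_xx w ≤ K` in the sense of distributions. -/
def SemiConcaveK (w : ℝ → ℝ) (K : ℝ) : Prop :=
  ConcaveOn ℝ univ (fun x => w x - K * x ^ 2 / 2)

/-- The class `ℰ`: functions that are (locally) the sum of a continuous and a
nonincreasing function. -/
def EClass (f : ℝ → ℝ) : Prop :=
  ∃ g h : ℝ → ℝ, Continuous g ∧ Antitone h ∧ ∀ x, f x = g x + h x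

/-- Right limit `f⁻(x)`. -/
def rlim (f : ℝ → ℝ) (q : ℝ) : ℝ := limUnder (nhdsWithin q (Ioi q)) f

/-- Left limit `f⁺(x)`. -/
def llim (f : ℝ → ℝ) (q : ℝ) : ℝ := limUnder (nhdsWithin q (Iio q)) f

def Gminus (f : ℝ → ℝ) : Set (ℝ × ℝ) := {z | z.2 = rlim f z.1}
def Gplus (f : ℝ → ℝ) : Set (ℝ × ℝ) := {z | z.2 = llim f z.1}

/-- The graph `G(f) = G⁻(f) ∩ G⁺(f)`. -/
def Ggraph (f : ℝ → ℝ) : Set (ℝ × ℝ) := Gminus f ∩ Gplus f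

/-- The closure of the graph, `G⁻(f) ∪ G⁺(f)`. -/
def Gbar (f : ℝ → ℝ) : Set (ℝ × ℝ) := Gminus f ∪ Gplus f

/-- The Jordan curve `H(f) = ⋃_x {x} × [f⁻(x), f⁺(x)]` (one period). -/
def Hset (f : ℝ → ℝ) : Set (ℝ × ℝ) :=
  {z | z.1 ∈ Icc (0:ℝ) 1 ∧ z.2 ∈ Icc (rlim f z.1) (llim f z.1)}

/-- Entropy solution of `∂_t y + ∂_x (H(t,x,y)) = 0` on `[t₀,∞) × 𝕋` (with its own
initial trace at `t₀`): distributional solution satisfying the Oleinik inequalities. -/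
def IsEntropySolOn (H : ℝ → ℝ → ℝ → ℝ) (t₀ : ℝ) (y : ℝ → ℝ → ℝ) : Prop :=
  (∀ t x, t₀ ≤ t → y t (x + 1) = y t x) ∧
  (∀ T, t₀ < T →
    IntegrableOn (fun z : ℝ × ℝ => y z.1 z.2) (Icc t₀ T ×ˢ Icc (0:ℝ) 1) volume ∧
    IntegrableOn (fun z : ℝ × ℝ => H z.1 z.2 (y z.1 z.2)) (Icc t₀ T ×ˢ Icc (0:ℝ) 1) volume) ∧
  (∀ φ : ℝ × ℝ → ℝ, ContDiff ℝ 2 φ → (∀ t x, φ (t, x + 1) = φ (t, x)) →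
    (∃ T, ∀ t x, T ≤ t → φ (t, x) = 0) →
    (∫ z in Ioi t₀ ×ˢ Ioc (0:ℝ) 1,
      (y z.1 z.2 * fderiv ℝ φ z (1, 0) + H z.1 z.2 (y z.1 z.2) * fderiv ℝ φ z (0, 1)))
      + ∫ x in (0:ℝ)..1, y t₀ x * φ (t₀, x) = 0) ∧
  (∃ K : ℝ → ℝ, (∀ t, t₀ < t → 0 < K t) ∧ AntitoneOn K (Ioi t₀) ∧
    ∀ t, t₀ < t → ∀ x δ, 0 < δ → y t (x + δ) - y t x ≤ K t * δ)

/-- `ξ` (with a.e. derivative `g`) is calibrated by `u` on `[a,b]`. -/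
def CalibratedCurve (H : ℝ → ℝ → ℝ → ℝ) (c : ℝ) (u : ℝ → ℝ → ℝ)
    (ξ g : ℝ → ℝ) (a b : ℝ) : Prop :=
  IsAC ξ g a b ∧
  IntervalIntegrable (fun s => Lag H s (ξ s) (g s) - c * g s) volume a b ∧
  u b (ξ b) = u a (ξ a) + ∫ s in a..b, (Lag H s (ξ s) (g s) - c * g s)

/-- `φ t₀ t` is the (lifted) flow of the Hamiltonian vector field of `H` between times
`t₀` and `t`. -/
def IsHamFlow (H : ℝ → ℝ → ℝ → ℝ) (φ : ℝ → ℝ → ℝ × ℝ → ℝ × ℝ) : Prop :=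
  (∀ t₀ z, φ t₀ t₀ z = z) ∧
  (∀ t₀ z t, HasDerivAt (fun s => φ t₀ s z) (HamVF H t (φ t₀ t z)) t) ∧
  (∀ t₀ t, Function.Bijective (φ t₀ t)) ∧
  (∀ t₀ t z, φ t₀ t (z + ((1:ℝ), (0:ℝ))) = φ t₀ t z + ((1:ℝ), (0:ℝ)))

/-- Periodic, measurable, integrable over a period: a representative of an element of
`L¹(𝕋)`. -/
def PerInt (y : ℝ → ℝ) : Prop :=
  (∀ x, y (x + 1) = y x) ∧ Measurable y ∧ IntervalIntegrable y volume 0 1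

/-- `E` is the time-one entropy evolution operator of `H` (extended to `L¹(𝕋)` by
`L¹`-continuity; it is considered up to a.e. equality, and satisfies the Oleinik bound). -/
structure IsEntropyOp (H : ℝ → ℝ → ℝ → ℝ) (E : (ℝ → ℝ) → (ℝ → ℝ)) : Prop where
  sol : ∀ y₀ : ℝ → ℝ, PerInt y₀ → (∃ M, ∀ x, |y₀ x| ≤ M) →
    ∃ y : ℝ → ℝ → ℝ, IsEntropySolOn H 0 y ∧ (∀ x, y 0 x = y₀ x) ∧ (∀ x, E y₀ x = y 1 x)
  maps : ∀ y, PerInt y → PerInt (E y)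
  oleinik : ∀ y, PerInt y → ∃ K, 0 < K ∧ ∀ x δ, 0 < δ → E y (x + δ) - E y x ≤ K * δ
  cont : ∀ y : ℝ → ℝ, PerInt y → ∀ z : ℕ → ℝ → ℝ, (∀ n, PerInt (z n)) →
    Tendsto (fun n => ∫ x in (0:ℝ)..1, |z n x - y x|) atTop (𝓝 0) →
    Tendsto (fun n => ∫ x in (0:ℝ)..1, |E (z n) x - E y x|) atTop (𝓝 0)

/-- Mather's alpha function: `C¹`, convex, superlinear, and every viscosity solution `u`
of `(HJc)` has `u + tα(c)` bounded. -/
def MatherAlpha (H : ℝ → ℝ → ℝ → ℝ) (α : ℝ → ℝ) : Prop :=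
  ContDiff ℝ 1 α ∧ ConvexOn ℝ univ α ∧
  Tendsto (fun c => α c / |c|) (Bornology.cobounded ℝ) atTop ∧
  ∀ c t₀ : ℝ, ∀ u : ℝ → ℝ → ℝ, IsViscSolOn H c t₀ u →
    ∃ M, ∀ t ∈ Ici t₀, ∀ x, |u t x + t * α c| ≤ M

end

/-- A `C²` Hamiltonian on the circle, `1`-periodic in time, with its partial derivatives
`Hx`, `Hp` and the inverse Legendre map `P`, whose Hamiltonian flow is complete. -/
structure HamData where
  /-- the Hamiltonian -/
  H : ℝ → ℝ → ℝ → ℝ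
  /-- the partial derivative `∂_x H` -/
  Hx : ℝ → ℝ → ℝ → ℝ
  /-- the partial derivative `∂_p H` -/
  Hp : ℝ → ℝ → ℝ → ℝ
  /-- the momentum associated with a velocity -/
  P : ℝ → ℝ → ℝ → ℝ
  contH : Continuous fun q : ℝ × ℝ × ℝ => H q.1 q.2.1 q.2.2
  strictH : ∀ t x p, HasStrictFDerivAt (fun z : ℝ × ℝ => H t z.1 z.2)
    (Hx t x p • ContinuousLinearMap.fst ℝ ℝ ℝ + Hp t x p • ContinuousLinearMap.snd ℝ ℝ ℝ) (x, p)
  contDiffHx : ContDiff ℝ 1 fun q : ℝ × ℝ × ℝ => Hx q.1 q.2.1 q.2.2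
  contDiffHp : ContDiff ℝ 1 fun q : ℝ × ℝ × ℝ => Hp q.1 q.2.1 q.2.2
  monoHp : ∀ t x, StrictMono (Hp t x)
  HpP : ∀ t x v, Hp t x (P t x v) = v
  perH_t : ∀ t x p, H (t + 1) x p = H t x p
  perH_x : ∀ t x p, H t (x + 1) p = H t x p
  perHx_t : ∀ t x p, Hx (t + 1) x p = Hx t x p
  perHx_x : ∀ t x p, Hx t (x + 1) p = Hx t x p
  perHp_t : ∀ t x p, Hp (t + 1) x p = Hp t x p
  perHp_x : ∀ t x p, Hp t (x + 1) p = Hp t x p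
  complete : ∀ t₀ : ℝ, ∀ z₀ : ℝ × ℝ, ∃ γ : ℝ → ℝ × ℝ, γ t₀ = z₀ ∧
    ∀ t, HasDerivAt γ (Hp t (γ t).1 (γ t).2, -Hx t (γ t).1 (γ t).2) t

theorem periodic_add_int {β : Type*} {g : ℝ → β} (hg : ∀ t, g (t + 1) = g t) (t : ℝ) (n : ℤ) :
    g (t + n) = g t := by
  have h : Function.Periodic g 1 := hg
  simpa using h.int_mul n t

theorem exists_bound_of_periodic {f : ℝ → ℝ → ℝ → ℝ}
    (hf : Continuous fun q : ℝ × ℝ × ℝ => f q.1 q.2.1 q.2.2)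
    (ht : ∀ t x p, f (t + 1) x p = f t x p) (hx : ∀ t x p, f t (x + 1) p = f t x p) (K : ℝ) :
    ∃ C, 0 ≤ C ∧ ∀ t x p, |p| ≤ K → |f t x p| ≤ C := by
  obtain ⟨C, hC⟩ := ((isCompact_Icc (a := (0 : ℝ)) (b := 1)).prod
    ((isCompact_Icc (a := (0 : ℝ)) (b := 1)).prod
      (isCompact_Icc (a := -K) (b := K)))).exists_bound_of_continuousOn hf.continuousOn
  refine ⟨max C 0, le_max_right _ _, fun t x p hp => ?_⟩
  have h1 : f t x p = f (Int.fract t) (Int.fract x) p := by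
    have e1 := periodic_add_int (g := fun s => f s x p) (fun s => ht s x p) (Int.fract t) ⌊t⌋
    have e2 := periodic_add_int (g := fun y => f (Int.fract t) y p)
      (fun y => hx (Int.fract t) y p) (Int.fract x) ⌊x⌋
    simp only [Int.fract_add_floor] at e1 e2
    rw [e1, e2]
  rw [h1]
  refine le_trans ?_ (le_max_left C 0)
  have := hC (Int.fract t, Int.fract x, p) ⟨⟨Int.fract_nonneg t, (Int.fract_lt_one t).le⟩,
    ⟨Int.fract_nonneg x, (Int.fract_lt_one x).le⟩, abs_le.mp hp⟩
  simpa using this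

namespace HamData

variable (D : HamData)

/-- The Lagrangian. -/
def L (t x v : ℝ) : ℝ := D.P t x v * v - D.H t x (D.P t x v)

theorem P_Hp (t x p : ℝ) : D.P t x (D.Hp t x p) = p :=
  (D.monoHp t x).injective (D.HpP t x _)

theorem perP_t (t x v : ℝ) : D.P (t + 1) x v = D.P t x v := by
  apply (D.monoHp t x).injective
  rw [D.HpP, ← D.perHp_t, D.HpP]

theorem perP_x (t x v : ℝ) : D.P t (x + 1) v = D.P t x v := by
  apply (D.monoHp t x).injective
  rw [D.HpP, ← D.perHp_x, D.HpP]

theorem perL_t (t x v : ℝ) : D.L (t + 1) x v = D.L t x v := by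
  simp only [L, D.perP_t, D.perH_t]

theorem perL_x (t x v : ℝ) : D.L t (x + 1) v = D.L t x v := by
  simp only [L, D.perP_x, D.perH_x]

theorem continuous_P : Continuous fun q : ℝ × ℝ × ℝ => D.P q.1 q.2.1 q.2.2 := by
  rw [continuous_iff_continuousAt]
  rintro ⟨t, x, v⟩
  have hc : ∀ a, Continuous fun q : ℝ × ℝ × ℝ => D.Hp q.1 q.2.1 a := fun a =>
    D.contDiffHp.continuous.comp
      (continuous_fst.prodMk ((continuous_fst.comp continuous_snd).prodMk continuous_const))
  have hv : Continuous fun q : ℝ × ℝ × ℝ => q.2.2 := by fun_prop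
  refine tendsto_order.2 ⟨fun a ha => ?_, fun a ha => ?_⟩
  · have h0 : D.Hp t x a < v := by
      have := D.monoHp t x ha
      rwa [D.HpP] at this
    filter_upwards [(hc a).continuousAt.eventually_lt hv.continuousAt (x₀ := (t, x, v)) h0]
      with q hq
    rw [← (D.monoHp q.1 q.2.1).lt_iff_lt, D.HpP]
    exact hq
  · have h0 : v < D.Hp t x a := by
      have := D.monoHp t x ha
      rwa [D.HpP] at this
    filter_upwards [hv.continuousAt.eventually_lt (hc a).continuousAt (x₀ := (t, x, v)) h0]
      with q hq
    rw [← (D.monoHp q.1 q.2.1).lt_iff_lt, D.HpP]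
    exact hq

theorem continuous_L : Continuous fun q : ℝ × ℝ × ℝ => D.L q.1 q.2.1 q.2.2 := by
  have h := D.continuous_P
  have h2 : Continuous fun q : ℝ × ℝ × ℝ => D.H q.1 q.2.1 (D.P q.1 q.2.1 q.2.2) :=
    D.contH.comp (continuous_fst.prodMk ((continuous_fst.comp continuous_snd).prodMk h))
  exact (h.mul (continuous_snd.comp continuous_snd)).sub h2

theorem hasDerivAt_H (t x p : ℝ) : HasDerivAt (D.H t x) (D.Hp t x p) p := by
  have h := (D.strictH t x p).hasFDerivAt.comp_hasDerivAt p
    ((hasDerivAt_const p x).prodMk (hasDerivAt_id p))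
  simpa [Function.comp_def] using h

theorem le_L (t x v p : ℝ) : p * v - D.H t x p ≤ D.L t x v := by
  have hd := D.hasDerivAt_H t x
  have hcont : Continuous (D.H t x) := by
    rw [continuous_iff_continuousAt]; exact fun p => (hd p).continuousAt
  have hv := D.HpP t x v
  rw [L]
  set q := D.P t x v
  rcases lt_trichotomy p q with h | h | h
  · obtain ⟨r, hr, e⟩ := exists_hasDerivAt_eq_slope (D.H t x) (D.Hp t x) h hcont.continuousOn
      (fun y _ => hd y)
    have h1 := D.monoHp t x hr.2
    rw [eq_div_iff (by linarith)] at e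
    nlinarith [hr.1, hr.2]
  · rw [h]
  · obtain ⟨r, hr, e⟩ := exists_hasDerivAt_eq_slope (D.H t x) (D.Hp t x) h hcont.continuousOn
      (fun y _ => hd y)
    have h1 := D.monoHp t x hr.1
    rw [eq_div_iff (by linarith)] at e
    nlinarith [hr.1, hr.2]

theorem L_Hp (t x p : ℝ) : D.L t x (D.Hp t x p) = p * D.Hp t x p - D.H t x p := by
  rw [L, P_Hp]

/-- Linear lower bounds with arbitrary slope for the Lagrangian. -/
theorem exists_coercive (A : ℝ) : ∃ B, 0 ≤ B ∧ ∀ t x v, A * |v| - B ≤ D.L t x v := by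
  obtain ⟨B, hB0, hB⟩ := exists_bound_of_periodic D.contH D.perH_t D.perH_x |A|
  refine ⟨B, hB0, fun t x v => ?_⟩
  rcases le_total 0 v with hv | hv
  · have h1 := D.le_L t x v A
    have h2 := (abs_le.mp (hB t x A le_rfl)).2
    rw [abs_of_nonneg hv]; linarith
  · have h1 := D.le_L t x v (-A)
    have h2 := (abs_le.mp (hB t x (-A) (by simp))).2
    rw [abs_of_nonpos hv]; linarith

theorem exists_L_bound (K : ℝ) : ∃ C, 0 ≤ C ∧ ∀ t x v, |v| ≤ K → |D.L t x v| ≤ C :=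
  exists_bound_of_periodic D.continuous_L D.perL_t D.perL_x K

theorem exists_P_bound (K : ℝ) : ∃ C, 0 ≤ C ∧ ∀ t x v, |v| ≤ K → |D.P t x v| ≤ C :=
  exists_bound_of_periodic D.continuous_P D.perP_t D.perP_x K

theorem hasFDerivAt_L (t x v : ℝ) : HasFDerivAt (fun z : ℝ × ℝ => D.L t z.1 z.2)
    ((-D.Hx t x (D.P t x v)) • ContinuousLinearMap.fst ℝ ℝ ℝ +
      D.P t x v • ContinuousLinearMap.snd ℝ ℝ ℝ) (x, v) := by
  rw [hasFDerivAt_iff_isLittleO]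
  set p₀ := D.P t x v with hp₀
  have hP : Tendsto (fun z : ℝ × ℝ => D.P t z.1 z.2) (𝓝 (x, v)) (𝓝 p₀) :=
    (D.continuous_P.comp (Continuous.prodMk_right t)).tendsto (x, v)
  have hfst : Tendsto (fun z : ℝ × ℝ => z.1) (𝓝 (x, v)) (𝓝 x) := continuous_fst.tendsto (x, v)
  have hs := (D.strictH t x p₀).isLittleO
  have key : ∀ g : ℝ × ℝ → ℝ, Tendsto g (𝓝 (x, v)) (𝓝 p₀) →
      (fun z : ℝ × ℝ => D.H t z.1 (g z) - D.H t x (g z) - D.Hx t x p₀ * (z.1 - x))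
        =o[𝓝 (x, v)] fun z => z - (x, v) := by
    intro g hg
    have h1 : Tendsto (fun z : ℝ × ℝ => ((z.1, g z), (x, g z))) (𝓝 (x, v))
        (𝓝 ((x, p₀), (x, p₀))) :=
      (hfst.prodMk_nhds hg).prodMk_nhds (tendsto_const_nhds.prodMk_nhds hg)
    have h2 := hs.comp_tendsto h1
    refine (h2.congr_left fun z => by simp).trans_isBigO ?_
    refine Asymptotics.IsBigO.of_bound 1 (Eventually.of_forall fun z => ?_)
    simp [Prod.norm_def]
  have k1 := key _ tendsto_const_nhds
  have k2 := key _ hP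
  have k3 : (fun z : ℝ × ℝ => (D.P t z.1 z.2 - p₀) * (z.2 - v))
      =o[𝓝 (x, v)] fun z => z - (x, v) := by
    have h1 : (fun z : ℝ × ℝ => D.P t z.1 z.2 - p₀) =o[𝓝 (x, v)] fun _ => (1 : ℝ) := by
      rw [Asymptotics.isLittleO_one_iff]
      simpa using hP.sub_const p₀
    have h2 : (fun z : ℝ × ℝ => z.2 - v) =O[𝓝 (x, v)] fun z => z - (x, v) := by
      refine Asymptotics.IsBigO.of_bound 1 (Eventually.of_forall fun z => ?_)
      simp [Prod.norm_def]
    simpa using (h1.mul_isBigO h2.norm_right)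
  have k4 := (k1.norm_left.add (k2.norm_left.add k3.norm_left))
  refine (Asymptotics.IsBigO.of_bound 1 (Eventually.of_forall fun z => ?_)).trans_isLittleO k4
  have l1 := D.le_L t z.1 z.2 p₀
  have l2 := D.le_L t x v (D.P t z.1 z.2)
  have e1 : D.L t x v = p₀ * v - D.H t x p₀ := rfl
  have e2 : D.L t z.1 z.2 = D.P t z.1 z.2 * z.2 - D.H t z.1 (D.P t z.1 z.2) := rfl
  have a1 := neg_abs_le (D.H t z.1 p₀ - D.H t x p₀ - D.Hx t x p₀ * (z.1 - x))
  have a2 := le_abs_self (D.H t z.1 p₀ - D.H t x p₀ - D.Hx t x p₀ * (z.1 - x))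
  have b1 := neg_abs_le (D.H t z.1 (D.P t z.1 z.2) - D.H t x (D.P t z.1 z.2) -
    D.Hx t x p₀ * (z.1 - x))
  have b2 := le_abs_self (D.H t z.1 (D.P t z.1 z.2) - D.H t x (D.P t z.1 z.2) -
    D.Hx t x p₀ * (z.1 - x))
  have c1 := neg_abs_le ((D.P t z.1 z.2 - p₀) * (z.2 - v))
  have c2 := le_abs_self ((D.P t z.1 z.2 - p₀) * (z.2 - v))
  have d1 := abs_nonneg (D.H t z.1 p₀ - D.H t x p₀ - D.Hx t x p₀ * (z.1 - x))
  have d2 := abs_nonneg (D.H t z.1 (D.P t z.1 z.2) - D.H t x (D.P t z.1 z.2) -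
    D.Hx t x p₀ * (z.1 - x))
  have d3 := abs_nonneg ((D.P t z.1 z.2 - p₀) * (z.2 - v))
  simp only [Real.norm_eq_abs, add_apply, smul_apply,
    ContinuousLinearMap.coe_fst', ContinuousLinearMap.coe_snd', Prod.fst_sub, Prod.snd_sub,
    smul_eq_mul, one_mul]
  rw [abs_of_nonneg (a := _ + (_ + _)) (by positivity), abs_le]
  constructor <;> nlinarith

end HamData

/-- Under the standing hypotheses, the superlinear convex Hamiltonian has a surjective
`∂_p H`. -/
theorem BurgersHyp.exists_deriv_eq {H : ℝ → ℝ → ℝ → ℝ} (hH : BurgersHyp H) (t x v : ℝ) :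
    ∃ p, deriv (fun q => H t x q) p = v := by
  have hd : Differentiable ℝ fun q => H t x q :=
    (hH.smooth.differentiable (by norm_num)).comp
      (f := fun q : ℝ => (t, x, q)) (by fun_prop)
  have hg : Tendsto (fun p => H t x p - v * p) (cocompact ℝ) atTop := by
    rw [← Metric.cobounded_eq_cocompact]
    have h1 := hH.superlinear t x
    refine tendsto_atTop_mono' _ ?_ (tendsto_norm_cobounded_atTop (E := ℝ))
    filter_upwards [h1.eventually_ge_atTop (|v| + 1),
      (tendsto_norm_cobounded_atTop (E := ℝ)).eventually_gt_atTop 0] with p hp hp0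
    rw [Real.norm_eq_abs] at hp0 ⊢
    rw [le_div_iff₀ hp0] at hp
    have h2 : v * p ≤ |v| * |p| := by rw [← abs_mul]; exact le_abs_self _
    linarith
  have hd2 : Differentiable ℝ fun p => H t x p - v * p := by fun_prop
  obtain ⟨p, hp⟩ := hd2.continuous.exists_forall_le hg
  refine ⟨p, ?_⟩
  have h3 : IsLocalMin (fun p => H t x p - v * p) p := Eventually.of_forall hp
  have h4 : HasDerivAt (fun p => H t x p - v * p) (deriv (fun q => H t x q) p - v * 1) p :=
    (hd p).hasDerivAt.sub ((hasDerivAt_id p).const_mul v)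
  have h5 := h3.hasDerivAt_eq_zero h4
  linarith

/-- The Hamiltonian `(t, x, p) ↦ H(t, x, c + p)` with all its data. -/
theorem BurgersHyp.exists_hamData {H : ℝ → ℝ → ℝ → ℝ} (hH : BurgersHyp H) (c : ℝ) :
    ∃ D : HamData, ∀ t x p, D.H t x p = H t x (c + p) := by
  choose Q hQ using hH.exists_deriv_eq
  set G : ℝ × ℝ × ℝ → ℝ := fun q => H q.1 q.2.1 (c + q.2.2) with hG
  have hGs : ContDiff ℝ 2 G :=
    hH.smooth.comp (f := fun q : ℝ × ℝ × ℝ => (q.1, q.2.1, c + q.2.2)) (by fun_prop)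
  have hGd : Differentiable ℝ G := hGs.differentiable (by norm_num)
  have hx : ∀ t x p, HasDerivAt (fun y => H t y (c + p)) (fderiv ℝ G (t, x, p) (0, 1, 0)) x := by
    intro t x p
    have h := (hGd (t, x, p)).hasFDerivAt.comp_hasDerivAt x
      ((hasDerivAt_const x t).prodMk ((hasDerivAt_id x).prodMk (hasDerivAt_const x p)))
    simpa [Function.comp_def, hG] using h
  have hp : ∀ t x p, HasDerivAt (fun q => H t x q) (fderiv ℝ G (t, x, p) (0, 0, 1)) (c + p) := by
    intro t x p
    have h := (hGd (t, x, c + p - c)).hasFDerivAt.comp_hasDerivAt (c + p)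
      ((hasDerivAt_const (c + p) t).prodMk ((hasDerivAt_const (c + p) x).prodMk
        ((hasDerivAt_id (c + p)).sub_const c)))
    simpa [Function.comp_def, hG] using h
  have hfd : ContDiff ℝ 1 (fderiv ℝ G) := hGs.fderiv_right (by norm_num)
  refine ⟨{
    H := fun t x p => H t x (c + p)
    Hx := fun t x p => fderiv ℝ G (t, x, p) (0, 1, 0)
    Hp := fun t x p => fderiv ℝ G (t, x, p) (0, 0, 1)
    P := fun t x v => Q t x v - c
    contH := hGs.continuous
    strictH := ?_
    contDiffHx := hfd.clm_apply contDiff_const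
    contDiffHp := hfd.clm_apply contDiff_const
    monoHp := ?_
    HpP := ?_
    perH_t := fun t x p => hH.per_t t x _
    perH_x := fun t x p => hH.per_x t x _
    perHx_t := ?_
    perHx_x := ?_
    perHp_t := ?_
    perHp_x := ?_
    complete := ?_ }, fun t x p => rfl⟩
  · intro t x p
    have h1 : HasStrictFDerivAt G (fderiv ℝ G (t, x, p)) (t, x, p) :=
      hGs.contDiffAt.hasStrictFDerivAt (by norm_num)
    have h2 : HasStrictFDerivAt (fun z : ℝ × ℝ => (t, z.1, z.2))
        ((0 : ℝ × ℝ →L[ℝ] ℝ).prod (ContinuousLinearMap.id ℝ (ℝ × ℝ))) (x, p) :=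
      (hasStrictFDerivAt_const t (x, p)).prodMk (hasStrictFDerivAt_id (x, p))
    refine (h1.comp (x, p) h2).congr_fderiv ?_
    ext <;> simp
  · intro t x a b hab
    have h1 : StrictMono (deriv fun q => H t x q) := by
      refine strictMono_of_deriv_pos fun q => ?_
      have := hH.convexp t x q
      rwa [iteratedDeriv_succ, iteratedDeriv_one] at this
    have h2 := h1 (show c + a < c + b by linarith)
    rwa [(hp t x a).deriv, (hp t x b).deriv] at h2
  · intro t x v
    have h1 := hp t x (Q t x v - c)
    rw [show c + (Q t x v - c) = Q t x v by ring] at h1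
    rw [← h1.deriv, hQ]
  · intro t x p
    rw [← (hx t x p).deriv, ← (hx (t + 1) x p).deriv]
    simp only [hH.per_t]
  · intro t x p
    have h1 := (hx t (x + 1) p).comp_add_const x 1
    simp only [hH.per_x] at h1
    exact h1.unique (hx t x p)
  · intro t x p
    rw [← (hp t x p).deriv, ← (hp (t + 1) x p).deriv]
    simp only [hH.per_t]
  · intro t x p
    rw [← (hp t x p).deriv, ← (hp t (x + 1) p).deriv]
    simp only [hH.per_x]
  · intro t₀ z₀
    obtain ⟨γ, h0, hγ⟩ := hH.complete t₀ (z₀.1, c + z₀.2)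
    refine ⟨fun t => ((γ t).1, (γ t).2 - c), by simp [h0], fun t => ?_⟩
    have h1 := hγ t
    have hp' := (hp t (γ t).1 ((γ t).2 - c)).deriv
    have hx' := (hx t (γ t).1 ((γ t).2 - c)).deriv
    rw [show c + ((γ t).2 - c) = (γ t).2 by ring] at hp' hx'
    have h2 : HasDerivAt (fun t => (γ t).1) (HamVF H t (γ t)).1 t :=
      (hasFDerivAt_fst (𝕜 := ℝ) (p := γ t)).comp_hasDerivAt t h1
    have h3 : HasDerivAt (fun t => (γ t).2) (HamVF H t (γ t)).2 t :=
      (hasFDerivAt_snd (𝕜 := ℝ) (p := γ t)).comp_hasDerivAt t h1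
    have h4 := h2.prodMk (h3.sub_const c)
    simpa only [HamVF, hp', hx'] using h4

namespace HamData

variable (D : HamData)

/-- Orbits of the symplectic Euler scheme of step `τ` started at time `s`. -/
def IsOrbit (τ s : ℝ) (J : ℕ) (x p : ℕ → ℝ) : Prop :=
  ∀ j < J, p (j + 1) = p j - τ * D.Hx (s + j * τ) (x j) (p j) ∧
    x (j + 1) = x j + τ * D.Hp (s + (j + 1) * τ) (x (j + 1)) (p (j + 1))

theorem exists_box_bound (a b M : ℝ) : ∃ Λ : ℝ, 0 ≤ Λ ∧
    ∀ t ∈ Icc a b, ∀ t' ∈ Icc a b, ∀ x x' p p' δ : ℝ, |x| ≤ M → |x'| ≤ M → |p| ≤ M → |p'| ≤ M →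
      |t - t'| ≤ δ → |x - x'| ≤ δ → |p - p'| ≤ δ →
      |D.Hx t x p - D.Hx t' x' p'| ≤ Λ * δ ∧ |D.Hp t x p - D.Hp t' x' p'| ≤ Λ * δ := by
  have hs : Convex ℝ (Icc a b ×ˢ Icc (-M) M ×ˢ Icc (-M) M) :=
    (convex_Icc a b).prod ((convex_Icc _ _).prod (convex_Icc _ _))
  have hk : IsCompact (Icc a b ×ˢ Icc (-M) M ×ˢ Icc (-M) M) :=
    isCompact_Icc.prod (isCompact_Icc.prod isCompact_Icc)
  obtain ⟨K₁, h₁⟩ := D.contDiffHx.contDiffOn.exists_lipschitzOnWith one_ne_zero hs hk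
  obtain ⟨K₂, h₂⟩ := D.contDiffHp.contDiffOn.exists_lipschitzOnWith one_ne_zero hs hk
  refine ⟨max K₁ K₂, by positivity, fun t ht t' ht' x x' p p' δ hx hx' hp hp' e1 e2 e3 => ?_⟩
  have m : (t, x, p) ∈ Icc a b ×ˢ Icc (-M) M ×ˢ Icc (-M) M := ⟨ht, abs_le.mp hx, abs_le.mp hp⟩
  have m' : (t', x', p') ∈ Icc a b ×ˢ Icc (-M) M ×ˢ Icc (-M) M :=
    ⟨ht', abs_le.mp hx', abs_le.mp hp'⟩
  have hd : dist (t, x, p) (t', x', p') ≤ δ := by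
    simp only [Prod.dist_eq, Real.dist_eq]
    exact max_le e1 (max_le e2 e3)
  have hδ : 0 ≤ δ := (abs_nonneg _).trans e1
  have r1 := h₁.dist_le_mul _ m _ m'
  have r2 := h₂.dist_le_mul _ m _ m'
  rw [Real.dist_eq] at r1 r2
  exact ⟨r1.trans (mul_le_mul (le_max_left _ _) hd dist_nonneg (by positivity)),
    r2.trans (mul_le_mul (le_max_right _ _) hd dist_nonneg (by positivity))⟩

theorem exists_mean_value {f f' : ℝ → ℝ} (hf : ∀ t, HasDerivAt f (f' t) t) {a b : ℝ}
    (hab : a < b) : ∃ σ ∈ Icc a b, f b = f a + (b - a) * f' σ := by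
  obtain ⟨σ, hσ, e⟩ := exists_hasDerivAt_eq_slope f f' hab
    (fun t _ => (hf t).continuousAt.continuousWithinAt) (fun t _ => hf t)
  refine ⟨σ, Ioo_subset_Icc_self hσ, ?_⟩
  rw [eq_div_iff (by linarith)] at e
  linarith

/-- Symplectic Euler orbits starting near a given point stay bounded for a unit of time:
they shadow the complete Hamiltonian trajectory of that point. -/
theorem exists_local_orbit_bound (t₀ x₀ p₀ : ℝ) : ∃ ε > (0 : ℝ), ∃ R : ℝ, ∀ τ : ℝ, 0 < τ → τ < ε →
    ∀ (s : ℝ) (J : ℕ) (x p : ℕ → ℝ), |s - t₀| < ε → |x 0 - x₀| < ε → |p 0 - p₀| < ε →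
      J * τ ≤ 1 → D.IsOrbit τ s J x p → ∀ j ≤ J, |p j| ≤ R := by
  obtain ⟨γ, h0, hγ⟩ := D.complete t₀ (x₀, p₀)
  have hγx : ∀ t, HasDerivAt (fun t => (γ t).1) (D.Hp t (γ t).1 (γ t).2) t := fun t =>
    (hasFDerivAt_fst (𝕜 := ℝ) (p := γ t)).comp_hasDerivAt t (hγ t)
  have hγp : ∀ t, HasDerivAt (fun t => (γ t).2) (-D.Hx t (γ t).1 (γ t).2) t := fun t =>
    (hasFDerivAt_snd (𝕜 := ℝ) (p := γ t)).comp_hasDerivAt t (hγ t)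
  have hγc : Continuous γ := by
    rw [continuous_iff_continuousAt]; exact fun t => (hγ t).continuousAt
  obtain ⟨M₀, hM₀⟩ := (isCompact_Icc (a := t₀ - 1) (b := t₀ + 2)).exists_bound_of_continuousOn
    hγc.continuousOn
  have hMx : ∀ t ∈ Icc (t₀ - 1) (t₀ + 2), |(γ t).1| ≤ M₀ := fun t ht =>
    (norm_fst_le (γ t)).trans (hM₀ t ht)
  have hMp : ∀ t ∈ Icc (t₀ - 1) (t₀ + 2), |(γ t).2| ≤ M₀ := fun t ht =>
    (norm_snd_le (γ t)).trans (hM₀ t ht)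
  obtain ⟨Λ, hΛ0, hΛ⟩ := D.exists_box_bound (t₀ - 1) (t₀ + 2) (M₀ + 1)
  obtain ⟨B₁, hB₁0, hB₁⟩ := exists_bound_of_periodic D.contDiffHx.continuous D.perHx_t D.perHx_x
    (M₀ + 1)
  obtain ⟨B₂, hB₂0, hB₂⟩ := exists_bound_of_periodic D.contDiffHp.continuous D.perHp_t D.perHp_x
    (M₀ + 1)
  set B := max B₁ B₂ with hB
  have hBx : ∀ t x p, |p| ≤ M₀ + 1 → |D.Hx t x p| ≤ B := fun t x p h =>
    (hB₁ t x p h).trans (le_max_left _ _)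
  have hBp : ∀ t x p, |p| ≤ M₀ + 1 → |D.Hp t x p| ≤ B := fun t x p h =>
    (hB₂ t x p h).trans (le_max_right _ _)
  have hB0 : 0 ≤ B := hB₁0.trans (le_max_left _ _)
  -- the trajectory is `B`-Lipschitz
  have lipx : ∀ t ∈ Icc (t₀ - 1) (t₀ + 2), ∀ t' ∈ Icc (t₀ - 1) (t₀ + 2), t < t' →
      |(γ t').1 - (γ t).1| ≤ B * (t' - t) ∧ |(γ t').2 - (γ t).2| ≤ B * (t' - t) := by
    intro t ht t' ht' htt
    obtain ⟨σ, hσ, e⟩ := exists_mean_value hγx htt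
    obtain ⟨σ', hσ', e'⟩ := exists_mean_value hγp htt
    have m : σ ∈ Icc (t₀ - 1) (t₀ + 2) := ⟨ht.1.trans hσ.1, hσ.2.trans ht'.2⟩
    have m' : σ' ∈ Icc (t₀ - 1) (t₀ + 2) := ⟨ht.1.trans hσ'.1, hσ'.2.trans ht'.2⟩
    have b := hBp σ (γ σ).1 (γ σ).2 ((hMp σ m).trans (by linarith))
    have b' := hBx σ' (γ σ').1 (γ σ').2 ((hMp σ' m').trans (by linarith))
    have htt' : 0 < t' - t := by linarith
    constructor
    · rw [e, add_sub_cancel_left, abs_mul, abs_of_pos htt', mul_comm]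
      gcongr
    · rw [e', add_sub_cancel_left, abs_mul, abs_of_pos htt', abs_neg, mul_comm]
      gcongr
  have lip : ∀ t ∈ Icc (t₀ - 1) (t₀ + 2), ∀ t' ∈ Icc (t₀ - 1) (t₀ + 2),
      |(γ t').1 - (γ t).1| ≤ B * |t' - t| ∧ |(γ t').2 - (γ t).2| ≤ B * |t' - t| := by
    intro t ht t' ht'
    rcases lt_trichotomy t t' with h | h | h
    · rw [abs_of_pos (sub_pos.2 h)]; exact lipx t ht t' ht' h
    · subst h; simp
    · have := lipx t' ht' t ht h
      rw [abs_sub_comm (γ t').1, abs_sub_comm (γ t').2, abs_sub_comm t', abs_of_pos (sub_pos.2 h)]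
      exact this
  set C := 1 + 2 * B with hC
  have hC0 : 0 < C := by positivity
  set ε := 1 / (2 * (1 + B + C) * Real.exp Λ) with hε
  have hexp : 1 ≤ Real.exp Λ := Real.one_le_exp hΛ0
  have hε0 : 0 < ε := by positivity
  have hεE : (1 + B + C) * ε * Real.exp Λ = 1 / 2 := by rw [hε]; field_simp
  have hεE' : (1 + B + C) * ε ≤ 1 / 2 := by
    rw [← hεE]; exact le_mul_of_one_le_right (by positivity) hexp
  have hε1 : ε ≤ 1 / 2 := by nlinarith
  refine ⟨ε, hε0, M₀ + 1, fun τ hτ0 hτ s J x p hs hx0 hp0 hJ horb => ?_⟩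
  set e : ℕ → ℝ := fun j => (1 + τ * Λ) ^ j * ((1 + B + C) * ε) - C * τ with he
  have hpow : ∀ j ≤ J, (1 + τ * Λ) ^ j ≤ Real.exp Λ := by
    intro j hj
    have hjJ : (j : ℝ) ≤ J := by exact_mod_cast hj
    calc (1 + τ * Λ) ^ j ≤ (Real.exp (τ * Λ)) ^ j := by
          gcongr; linarith [Real.add_one_le_exp (τ * Λ)]
      _ = Real.exp (j * τ * Λ) := by rw [← Real.exp_nat_mul]; ring_nf
      _ ≤ Real.exp Λ := by
          apply Real.exp_le_exp.2
          nlinarith [mul_le_mul_of_nonneg_right hjJ hτ0.le]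
  have he1 : ∀ j ≤ J, e j + C * τ ≤ 1 / 2 := by
    intro j hj
    have h1 := hpow j hj
    have : e j + C * τ = (1 + τ * Λ) ^ j * ((1 + B + C) * ε) := by simp [he]
    rw [this, ← hεE, mul_comm]
    gcongr
  have hesucc : ∀ j, e (j + 1) = e j + τ * (Λ * (e j + C * τ)) := by
    intro j; simp only [he, pow_succ]; ring
  have hT : ∀ j ≤ J, s + j * τ ∈ Icc (t₀ - 1) (t₀ + 2) := by
    intro j hj
    have hjJ : (j : ℝ) ≤ J := by exact_mod_cast hj
    have h1 := mul_le_mul_of_nonneg_right hjJ hτ0.le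
    have h2 : 0 ≤ (j : ℝ) * τ := by positivity
    have := abs_lt.mp hs
    constructor <;> linarith
  have main : ∀ j ≤ J, |x j - (γ (s + j * τ)).1| ≤ e j ∧ |p j - (γ (s + j * τ)).2| ≤ e j := by
    intro j
    induction j with
    | zero =>
      intro _
      have h1 := hT 0 (Nat.zero_le _)
      have h2 : t₀ ∈ Icc (t₀ - 1) (t₀ + 2) := ⟨by linarith, by linarith⟩
      have h3 := lip t₀ h2 _ h1
      have e0 : ε + B * ε ≤ e 0 := by
        simp only [he, pow_zero]
        nlinarith
      simp only [Nat.cast_zero, zero_mul, add_zero, h0] at h3 ⊢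
      have h4 : B * |s - t₀| ≤ B * ε := by gcongr
      constructor
      · rw [abs_sub_comm] at h3
        calc |x 0 - (γ s).1| = |(x 0 - x₀) + (x₀ - (γ s).1)| := by ring_nf
          _ ≤ |x 0 - x₀| + |x₀ - (γ s).1| := abs_add_le _ _
          _ ≤ e 0 := by linarith [h3.1]
      · rw [abs_sub_comm (γ s).2] at h3
        calc |p 0 - (γ s).2| = |(p 0 - p₀) + (p₀ - (γ s).2)| := by ring_nf
          _ ≤ |p 0 - p₀| + |p₀ - (γ s).2| := abs_add_le _ _
          _ ≤ e 0 := by linarith [h3.2]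
    | succ j ih =>
      intro hj
      obtain ⟨ihx, ihp⟩ := ih (by omega)
      obtain ⟨op, ox⟩ := horb j (by omega)
      have T := hT j (by omega)
      have T' := hT (j + 1) hj
      have hlt : s + j * τ < s + (j + 1 : ℕ) * τ := by push_cast; linarith
      have hlen : s + (j + 1 : ℕ) * τ - (s + j * τ) = τ := by push_cast; ring
      obtain ⟨σ, hσ, ex⟩ := exists_mean_value hγx hlt
      obtain ⟨σ', hσ', ep⟩ := exists_mean_value hγp hlt
      rw [hlen] at ex ep
      have mσ : σ ∈ Icc (t₀ - 1) (t₀ + 2) := ⟨T.1.trans hσ.1, hσ.2.trans T'.2⟩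
      have mσ' : σ' ∈ Icc (t₀ - 1) (t₀ + 2) := ⟨T.1.trans hσ'.1, hσ'.2.trans T'.2⟩
      have dσ1 : |s + j * τ - σ| ≤ τ := by
        rw [abs_le]; constructor <;> linarith [hσ.1, hσ.2]
      have dσ2 : |s + (j + 1 : ℕ) * τ - σ| ≤ τ := by
        rw [abs_le]; constructor <;> linarith [hσ.1, hσ.2]
      have dσ' : |s + j * τ - σ'| ≤ τ := by
        rw [abs_le]; constructor <;> linarith [hσ'.1, hσ'.2]
      have E := he1 j (by omega)
      have hCτ : C * τ = τ + 2 * (B * τ) := by rw [hC]; ring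
      have hBτ : 0 ≤ B * τ := by positivity
      have ej0 : 0 ≤ e j := (abs_nonneg _).trans ihx
      have γj := hMx _ T
      have γj' := hMp _ T
      have xj : |x j| ≤ M₀ + 1 / 2 - C * τ := by
        have := abs_add_le (x j - (γ (s + j * τ)).1) (γ (s + j * τ)).1
        rw [sub_add_cancel] at this
        linarith
      have pj : |p j| ≤ M₀ + 1 / 2 - C * τ := by
        have := abs_add_le (p j - (γ (s + j * τ)).2) (γ (s + j * τ)).2
        rw [sub_add_cancel] at this
        linarith
      have dp : |p (j + 1) - p j| ≤ B * τ := by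
        have h := hBx (s + j * τ) (x j) (p j) (by linarith)
        rw [op, sub_sub_cancel_left, abs_neg, abs_mul, abs_of_pos hτ0, mul_comm]
        gcongr
      have pj1 : |p (j + 1)| ≤ M₀ + 1 := by
        have := abs_add_le (p (j + 1) - p j) (p j)
        rw [sub_add_cancel] at this
        linarith
      have dx : |x (j + 1) - x j| ≤ B * τ := by
        have h := hBp (s + (j + 1) * τ) (x (j + 1)) (p (j + 1)) pj1
        rw [show x (j + 1) - x j = τ * D.Hp (s + (j + 1) * τ) (x (j + 1)) (p (j + 1)) by linarith,
          abs_mul, abs_of_pos hτ0, mul_comm]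
        gcongr
      have xj1 : |x (j + 1)| ≤ M₀ + 1 := by
        have := abs_add_le (x (j + 1) - x j) (x j)
        rw [sub_add_cancel] at this
        linarith
      have g1 := lip _ mσ _ T
      have g2 := lip _ mσ' _ T
      have bnd1 : B * |s + j * τ - σ| ≤ B * τ := by gcongr
      have bnd2 : B * |s + j * τ - σ'| ≤ B * τ := by gcongr
      have kp := (hΛ _ T σ' mσ' (x j) (γ σ').1 (p j) (γ σ').2 (e j + C * τ) (by linarith)
        ((hMx _ mσ').trans (by linarith)) (by linarith) ((hMp _ mσ').trans (by linarith))
        (by linarith)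
        (by
          have := abs_add_le (x j - (γ (s + j * τ)).1) ((γ (s + j * τ)).1 - (γ σ').1)
          rw [sub_add_sub_cancel] at this
          linarith [g2.1])
        (by
          have := abs_add_le (p j - (γ (s + j * τ)).2) ((γ (s + j * τ)).2 - (γ σ').2)
          rw [sub_add_sub_cancel] at this
          linarith [g2.2])).1
      have kx := (hΛ _ T' σ mσ (x (j + 1)) (γ σ).1 (p (j + 1)) (γ σ).2 (e j + C * τ) (by linarith)
        ((hMx _ mσ).trans (by linarith)) (by linarith) ((hMp _ mσ).trans (by linarith))
        (by linarith)
        (by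
          have h1 := abs_add_le (x j - (γ (s + j * τ)).1) ((γ (s + j * τ)).1 - (γ σ).1)
          have h2 := abs_add_le (x (j + 1) - x j) (x j - (γ σ).1)
          rw [sub_add_sub_cancel] at h1 h2
          linarith [g1.1])
        (by
          have h1 := abs_add_le (p j - (γ (s + j * τ)).2) ((γ (s + j * τ)).2 - (γ σ).2)
          have h2 := abs_add_le (p (j + 1) - p j) (p j - (γ σ).2)
          rw [sub_add_sub_cancel] at h1 h2
          linarith [g1.2])).2
      rw [hesucc]
      constructor
      · have : x (j + 1) - (γ (s + (j + 1 : ℕ) * τ)).1 = (x j - (γ (s + j * τ)).1) +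
            τ * (D.Hp (s + (j + 1 : ℕ) * τ) (x (j + 1)) (p (j + 1)) -
              D.Hp σ (γ σ).1 (γ σ).2) := by
          rw [ex]; push_cast; linarith
        rw [this]
        refine (abs_add_le _ _).trans (add_le_add ihx ?_)
        rw [abs_mul, abs_of_pos hτ0]
        gcongr
      · have : p (j + 1) - (γ (s + (j + 1 : ℕ) * τ)).2 = (p j - (γ (s + j * τ)).2) +
            τ * -(D.Hx (s + j * τ) (x j) (p j) - D.Hx σ' (γ σ').1 (γ σ').2) := by
          rw [ep, op]; ring
        rw [this]
        refine (abs_add_le _ _).trans (add_le_add ihp ?_)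
        rw [abs_mul, abs_of_pos hτ0, abs_neg]
        gcongr
  intro j hj
  have h1 := (main j hj).2
  have h2 := hMp _ (hT j hj)
  have h3 := he1 j hj
  have := abs_add_le (p j - (γ (s + j * τ)).2) (γ (s + j * τ)).2
  rw [sub_add_cancel] at this
  have : 0 ≤ C * τ := by positivity
  linarith

theorem exists_orbit_bound_of_mem_Icc (P₀ : ℝ) : ∃ ε > (0 : ℝ), ∃ R : ℝ, ∀ τ : ℝ, 0 < τ → τ < ε →
    ∀ (s : ℝ) (J : ℕ) (x p : ℕ → ℝ), s ∈ Icc (0 : ℝ) 1 → x 0 ∈ Icc (0 : ℝ) 1 → |p 0| ≤ P₀ →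
      J * τ ≤ 1 → D.IsOrbit τ s J x p → ∀ j ≤ J, |p j| ≤ R := by
  have hK : IsCompact (Icc (0 : ℝ) 1 ×ˢ Icc (0 : ℝ) 1 ×ˢ Icc (-P₀) P₀) :=
    isCompact_Icc.prod (isCompact_Icc.prod isCompact_Icc)
  have := hK.induction_on (p := fun S => ∃ ε > (0 : ℝ), ∃ R : ℝ, ∀ τ : ℝ, 0 < τ → τ < ε →
    ∀ (s : ℝ) (J : ℕ) (x p : ℕ → ℝ), (s, x 0, p 0) ∈ S →
      J * τ ≤ 1 → D.IsOrbit τ s J x p → ∀ j ≤ J, |p j| ≤ R)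
    ⟨1, one_pos, 0, fun _ _ _ _ _ _ _ h => h.elim⟩
    (fun S T hST ⟨ε, h0, R, h⟩ => ⟨ε, h0, R, fun τ h1 h2 s J x p hm => h τ h1 h2 s J x p (hST hm)⟩)
    (fun S T ⟨ε, h0, R, h⟩ ⟨ε', h0', R', h'⟩ => ⟨min ε ε', lt_min h0 h0', max R R',
      fun τ h1 h2 s J x p hm hJ ho j hj => hm.elim
        (fun hm => (h τ h1 (h2.trans_le (min_le_left _ _)) s J x p hm hJ ho j hj).trans
          (le_max_left _ _))
        (fun hm => (h' τ h1 (h2.trans_le (min_le_right _ _)) s J x p hm hJ ho j hj).trans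
          (le_max_right _ _))⟩)
    (by
      rintro ⟨t₀, x₀, p₀⟩ -
      obtain ⟨ε, h0, R, h⟩ := D.exists_local_orbit_bound t₀ x₀ p₀
      refine ⟨Metric.ball (t₀, x₀, p₀) ε, mem_nhdsWithin_of_mem_nhds (Metric.ball_mem_nhds _ h0),
        ε, h0, R, fun τ h1 h2 s J x p hm => ?_⟩
      simp only [Metric.mem_ball, Prod.dist_eq, Real.dist_eq, max_lt_iff] at hm
      exact h τ h1 h2 s J x p hm.1 hm.2.1 hm.2.2)
  obtain ⟨ε, h0, R, h⟩ := this
  exact ⟨ε, h0, R, fun τ h1 h2 s J x p hs hx hp => h τ h1 h2 s J x p ⟨hs, hx, abs_le.mp hp⟩⟩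

/-- Symplectic Euler orbits starting with momentum at most `P₀` stay bounded for a unit of
time, uniformly with respect to the (small) step. -/
theorem exists_orbit_bound (P₀ : ℝ) : ∃ ε > (0 : ℝ), ∃ R : ℝ, ∀ τ : ℝ, 0 < τ → τ < ε →
    ∀ (s : ℝ) (J : ℕ) (x p : ℕ → ℝ), |p 0| ≤ P₀ →
      J * τ ≤ 1 → D.IsOrbit τ s J x p → ∀ j ≤ J, |p j| ≤ R := by
  obtain ⟨ε, h0, R, h⟩ := D.exists_orbit_bound_of_mem_Icc P₀
  refine ⟨ε, h0, R, fun τ h1 h2 s J x p hp hJ ho => ?_⟩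
  refine h τ h1 h2 (Int.fract s) J (fun j => x j - ⌊x 0⌋) p
    ⟨Int.fract_nonneg s, (Int.fract_lt_one s).le⟩
    ⟨Int.fract_nonneg (x 0), (Int.fract_lt_one (x 0)).le⟩ hp hJ fun j hj => ?_
  obtain ⟨o1, o2⟩ := ho j hj
  have e1 : ∀ a y q, D.Hx (s + a) y q = D.Hx (Int.fract s + a) (y - ⌊x 0⌋) q := by
    intro a y q
    have r1 := periodic_add_int (g := fun t => D.Hx t y q) (fun t => D.perHx_t t y q)
      (Int.fract s + a) ⌊s⌋
    have r2 := periodic_add_int (g := fun z => D.Hx (Int.fract s + a) z q)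
      (fun z => D.perHx_x _ z q) (y - ⌊x 0⌋) ⌊x 0⌋
    rw [show Int.fract s + a + ⌊s⌋ = s + a by rw [add_right_comm, Int.fract_add_floor]] at r1
    rw [sub_add_cancel] at r2
    exact r1.trans r2
  have e2 : ∀ a y q, D.Hp (s + a) y q = D.Hp (Int.fract s + a) (y - ⌊x 0⌋) q := by
    intro a y q
    have r1 := periodic_add_int (g := fun t => D.Hp t y q) (fun t => D.perHp_t t y q)
      (Int.fract s + a) ⌊s⌋
    have r2 := periodic_add_int (g := fun z => D.Hp (Int.fract s + a) z q)
      (fun z => D.perHp_x _ z q) (y - ⌊x 0⌋) ⌊x 0⌋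
    rw [show Int.fract s + a + ⌊s⌋ = s + a by rw [add_right_comm, Int.fract_add_floor]] at r1
    rw [sub_add_cancel] at r2
    exact r1.trans r2
  refine ⟨by rw [← e1]; exact o1, ?_⟩
  rw [← e2]
  linarith

end HamData

/-- A continuous function with upper supports of slope at most `R` at every point grows at
most at rate `R`. -/
theorem sub_le_of_upper_support {f : ℝ → ℝ} (hf : Continuous f) {R : ℝ}
    (h : ∀ x, ∃ g : ℝ → ℝ, ∃ q, |q| ≤ R ∧ HasDerivAt g q x ∧ ∀ y, f y - f x ≤ g y - g x)
    {a b : ℝ} (hab : a ≤ b) : f b - f a ≤ R * (b - a) := by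
  have := image_le_of_liminf_slope_right_le_deriv_boundary (f := f) (a := a) (b := b)
    hf.continuousOn (B := fun x => f a + R * (x - a)) (B' := fun _ => R) (by simp)
    (by fun_prop)
    (fun x _ => by
      have := (((hasDerivAt_id x).sub_const a).const_mul R).const_add (f a)
      simpa using this.hasDerivWithinAt)
    (fun x _ r hr => by
      obtain ⟨g, q, hq, hg, hfg⟩ := h x
      have h1 : Tendsto (slope g x) (𝓝[>] x) (𝓝 q) :=
        (hasDerivAt_iff_tendsto_slope.1 hg).mono_left
          (nhdsWithin_mono _ fun y hy => ne_of_gt hy)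
      refine Eventually.frequently ?_
      filter_upwards [h1.eventually_lt_const (((le_abs_self q).trans hq).trans_lt hr),
        self_mem_nhdsWithin] with y hy hxy
      refine lt_of_le_of_lt ?_ hy
      rw [slope_def_field, slope_def_field]
      exact div_le_div_of_nonneg_right (hfg y) (sub_nonneg.2 (le_of_lt hxy)))
    (right_mem_Icc.2 hab)
  linarith

theorem abs_sub_le_of_upper_support {f : ℝ → ℝ} (hf : Continuous f) {R : ℝ}
    (h : ∀ x, ∃ g : ℝ → ℝ, ∃ q, |q| ≤ R ∧ HasDerivAt g q x ∧ ∀ y, f y - f x ≤ g y - g x)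
    (a b : ℝ) : |f a - f b| ≤ R * |a - b| := by
  have key : ∀ a b : ℝ, a ≤ b → |f a - f b| ≤ R * |a - b| := by
    intro a b hab
    have h1 := sub_le_of_upper_support hf h hab
    have h2 := sub_le_of_upper_support (f := fun x => f (-x)) (hf.comp continuous_neg) (R := R)
      (fun x => by
        obtain ⟨g, q, hq, hg, hfg⟩ := h (-x)
        refine ⟨fun y => g (-y), -q, by rwa [abs_neg], ?_, fun y => hfg (-y)⟩
        simpa [Function.comp_def] using hg.scomp x (hasDerivAt_neg x))
      (neg_le_neg hab)
    simp only [neg_neg] at h2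
    rw [abs_sub_comm a b, abs_of_nonneg (sub_nonneg.2 hab), abs_le]
    constructor <;> linarith
  rcases le_total a b with h0 | h0
  · exact key a b h0
  · rw [abs_sub_comm (f a), abs_sub_comm a]; exact key b a h0

namespace HamData

variable (D : HamData)

/-- `w` is obtained from `u` by one step of length `τ` of the discrete Lax–Oleinik scheme,
the infimum being attained. -/
def IsStep (τ t : ℝ) (u w : ℝ → ℝ) : Prop :=
  ∀ x, (∀ y, w x ≤ u y + τ * D.L t x ((x - y) / τ)) ∧
    ∃ y, w x = u y + τ * D.L t x ((x - y) / τ)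

/-- `u` is a solution of the discrete Lax–Oleinik scheme of step `τ`. -/
def IsScheme (τ : ℝ) (u : ℕ → ℝ → ℝ) : Prop :=
  ∀ k : ℕ, D.IsStep τ ((k + 1) * τ) (u k) (u (k + 1))

variable {D}

theorem IsStep.mono {τ t : ℝ} {u w u' w' : ℝ → ℝ} (h : D.IsStep τ t u w)
    (h' : D.IsStep τ t u' w') {δ : ℝ} (hu : ∀ x, u x ≤ u' x + δ) (x : ℝ) : w x ≤ w' x + δ := by
  obtain ⟨y, hy⟩ := (h' x).2
  have h1 := (h x).1 y
  have h2 := hu y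
  linarith

theorem IsStep.time_sub_one {τ t : ℝ} {u w : ℝ → ℝ} (h : D.IsStep τ (t + 1) u w) :
    D.IsStep τ t u w := by
  simpa only [IsStep, D.perL_t] using h

theorem IsStep.comp_add_one {τ t : ℝ} {u w : ℝ → ℝ} (h : D.IsStep τ t u w) :
    D.IsStep τ t (fun x => u (x + 1)) (fun x => w (x + 1)) := by
  intro x
  refine ⟨fun y => ?_, ?_⟩
  · have := (h (x + 1)).1 (y + 1)
    rwa [D.perL_x, add_sub_add_right_eq_sub] at this
  · obtain ⟨y, hy⟩ := (h (x + 1)).2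
    refine ⟨y - 1, ?_⟩
    rw [D.perL_x] at hy
    show w (x + 1) = u (y - 1 + 1) + τ * D.L t x ((x - (y - 1)) / τ)
    rw [sub_add_cancel, show x - (y - 1) = x + 1 - y by ring]
    exact hy

theorem IsScheme.mono {τ : ℝ} {u u' : ℕ → ℝ → ℝ} (h : D.IsScheme τ u) (h' : D.IsScheme τ u')
    {δ : ℝ} (hu : ∀ x, u 0 x ≤ u' 0 x + δ) (k : ℕ) : ∀ x, u k x ≤ u' k x + δ := by
  induction k with
  | zero => exact hu
  | succ k ih => exact (h k).mono (h' k) ih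

theorem IsScheme.abs_sub_le {τ : ℝ} {u u' : ℕ → ℝ → ℝ} (h : D.IsScheme τ u)
    (h' : D.IsScheme τ u') {δ : ℝ} (hu : ∀ x, |u 0 x - u' 0 x| ≤ δ) (k : ℕ) (x : ℝ) :
    |u k x - u' k x| ≤ δ := by
  have h1 := h.mono h' (δ := δ) (fun x => by linarith [(abs_le.mp (hu x)).2]) k x
  have h2 := h'.mono h (δ := δ) (fun x => by linarith [(abs_le.mp (hu x)).1]) k x
  rw [abs_le]; constructor <;> linarith

theorem IsScheme.comp_add_one {τ : ℝ} {u : ℕ → ℝ → ℝ} (h : D.IsScheme τ u) :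
    D.IsScheme τ fun k x => u k (x + 1) := fun k => (h k).comp_add_one

theorem IsScheme.shift_period {τ : ℝ} {u : ℕ → ℝ → ℝ} (h : D.IsScheme τ u) {N : ℕ}
    (hN : N * τ = 1) : D.IsScheme τ fun k => u (N + k) := by
  intro k
  have h1 := h (N + k)
  rw [show ((N + k : ℕ) + 1 : ℝ) * τ = (k + 1) * τ + 1 by push_cast; linarith] at h1
  exact h1.time_sub_one

variable (D)

theorem exists_step {τ : ℝ} (hτ : 0 < τ) (t : ℝ) (u : BoundedContinuousFunction ℝ ℝ) :
    ∃ w : BoundedContinuousFunction ℝ ℝ, D.IsStep τ t u w := by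
  set M := ‖u‖
  have hM : ∀ y, |u y| ≤ M := fun y => u.norm_coe_le_norm y
  obtain ⟨B, hB0, hB⟩ := D.exists_coercive 1
  obtain ⟨C, hC0, hC⟩ := D.exists_L_bound 0
  have hC' : ∀ x, D.L t x 0 ≤ C := fun x => (abs_le.mp (hC t x 0 (by simp))).2
  set f : ℝ → ℝ → ℝ := fun x v => u (x - τ * v) + τ * D.L t x v with hf
  have hfc : Continuous (Function.uncurry f) := by
    have h1 : Continuous fun q : ℝ × ℝ => D.L t q.1 q.2 :=
      D.continuous_L.comp (Continuous.prodMk_right t)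
    exact (u.continuous.comp (continuous_fst.sub (continuous_const.mul continuous_snd))).add
      (continuous_const.mul h1)
  set K := 2 * M / τ + C + B with hK
  have hM0 : 0 ≤ M := norm_nonneg _
  have hK0 : 0 ≤ K := by positivity
  have hlow : ∀ x v, -M - τ * B ≤ f x v := by
    intro x v
    have h1 := hB t x v
    have h2 := (abs_le.mp (hM (x - τ * v))).1
    have h3 : τ * -B ≤ τ * D.L t x v := by
      gcongr; linarith [abs_nonneg v]
    simp only [hf]; linarith
  have hfar : ∀ x v, K < |v| → f x 0 ≤ f x v := by
    intro x v hv
    have h1 := hB t x v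
    have h2 := (abs_le.mp (hM (x - τ * v))).1
    have h3 := (abs_le.mp (hM (x - τ * 0))).2
    have h4 : τ * (2 * M / τ + C) ≤ τ * D.L t x v := by
      gcongr; linarith
    have h5 : τ * D.L t x 0 ≤ τ * C := by gcongr; exact hC' x
    have h6 : τ * (2 * M / τ + C) = 2 * M + τ * C := by field_simp
    simp only [hf]; linarith
  have hne : (Icc (-K) K).Nonempty := ⟨0, by simpa using hK0⟩
  have hcf : ∀ x, Continuous (f x) := fun x => hfc.comp (Continuous.prodMk_right x)
  have hbdd : ∀ x, BddBelow (f x '' Icc (-K) K) := fun x =>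
    ⟨-M - τ * B, by rintro _ ⟨v, -, rfl⟩; exact hlow x v⟩
  set w : ℝ → ℝ := fun x => sInf (f x '' Icc (-K) K) with hw
  have hwc : Continuous w := isCompact_Icc.continuous_sInf hfc
  have hle : ∀ x v, w x ≤ f x v := by
    intro x v
    by_cases hv : |v| ≤ K
    · exact csInf_le (hbdd x) ⟨v, abs_le.mp hv, rfl⟩
    · exact (csInf_le (hbdd x) ⟨0, by simpa using hK0, rfl⟩).trans (hfar x v (not_le.mp hv))
  have hex : ∀ x, ∃ v, w x = f x v := by
    intro x
    obtain ⟨v, -, hv⟩ := isCompact_Icc.exists_sInf_image_eq hne (hcf x).continuousOn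
    exact ⟨v, hv⟩
  have hwb : ∀ x, ‖w x‖ ≤ M + τ * B + τ * C := by
    intro x
    obtain ⟨v, hv⟩ := hex x
    have h1 := hlow x v
    have h2 := hle x 0
    have h3 := (abs_le.mp (hM (x - τ * 0))).2
    have h5 : τ * D.L t x 0 ≤ τ * C := by gcongr; exact hC' x
    have h6 : 0 ≤ τ * C := by positivity
    have h7 : 0 ≤ τ * B := by positivity
    simp only [hf] at h2
    rw [Real.norm_eq_abs, abs_le]
    constructor <;> linarith
  refine ⟨BoundedContinuousFunction.ofNormedAddCommGroup w hwc _ hwb, fun x => ⟨fun y => ?_, ?_⟩⟩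
  · have := hle x ((x - y) / τ)
    simp only [hf] at this
    rwa [mul_div_cancel₀ _ hτ.ne', sub_sub_cancel] at this
  · obtain ⟨v, hv⟩ := hex x
    refine ⟨x - τ * v, ?_⟩
    rw [sub_sub_cancel, mul_div_cancel_left₀ _ hτ.ne']
    exact hv

/-- The orbit of `u` under the discrete Lax–Oleinik scheme. -/
noncomputable def orb (τ : ℝ) (u : BoundedContinuousFunction ℝ ℝ) :
    ℕ → BoundedContinuousFunction ℝ ℝ
  | 0 => u
  | k + 1 => Classical.epsilon fun w : BoundedContinuousFunction ℝ ℝ =>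
      D.IsStep τ ((k + 1) * τ) (orb τ u k) w

theorem isScheme_orb {τ : ℝ} (hτ : 0 < τ) (u : BoundedContinuousFunction ℝ ℝ) :
    D.IsScheme τ fun k => D.orb τ u k := fun k =>
  Classical.epsilon_spec (D.exists_step hτ ((k + 1) * τ) (D.orb τ u k))

/-- Discounted periodic solutions of the discrete scheme. -/
theorem exists_discounted {N : ℕ} (hN : 1 ≤ N) : ∃ u : ℕ → ℝ → ℝ,
    (∀ k, Continuous (u k)) ∧ (∀ k x, u k (x + 1) = u k x) ∧ D.IsScheme (1 / N) u ∧
      ∀ x, u 0 x = (1 - 1 / N) * u N x := by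
  have hN0 : (1 : ℝ) ≤ N := by exact_mod_cast hN
  have hτ : (0 : ℝ) < 1 / N := by positivity
  have hτ1 : (1 : ℝ) / N ≤ 1 := by rw [div_le_one (by positivity)]; exact hN0
  set τ : ℝ := 1 / N
  set r : NNReal := ⟨1 - τ, by linarith⟩ with hr
  have hr' : (r : ℝ) = 1 - τ := rfl
  set T : BoundedContinuousFunction ℝ ℝ → BoundedContinuousFunction ℝ ℝ :=
    fun u => (1 - τ) • D.orb τ u N with hT
  have hc : ContractingWith r T := by
    refine ⟨?_, LipschitzWith.of_dist_le_mul fun u w => ?_⟩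
    · rw [← NNReal.coe_lt_coe, hr']; simp [hτ]
    · rw [BoundedContinuousFunction.dist_le (by positivity)]
      intro x
      have h1 := (D.isScheme_orb hτ u).abs_sub_le (D.isScheme_orb hτ w) (δ := dist u w)
        (fun x => BoundedContinuousFunction.dist_coe_le_dist (f := u) (g := w) x) N x
      simp only [hT, BoundedContinuousFunction.coe_smul, smul_eq_mul, Real.dist_eq]
      rw [← mul_sub, abs_mul, abs_of_nonneg (by linarith), hr']
      gcongr
  set u := ContractingWith.fixedPoint T hc
  have hu : T u = u := hc.fixedPoint_isFixedPt
  have hu0 : ∀ x, u x = (1 - τ) * D.orb τ u N x := fun x => by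
    conv_lhs => rw [← hu]
    simp [hT]
  have hs := D.isScheme_orb hτ u
  set u' : BoundedContinuousFunction ℝ ℝ :=
    u.compContinuous ⟨fun x => x + 1, by fun_prop⟩ with hu'
  have hd : dist u' u ≤ (1 - τ) * dist u' u := by
    rw [BoundedContinuousFunction.dist_le (mul_nonneg (by linarith) dist_nonneg)]
    intro x
    have h1 := hs.comp_add_one.abs_sub_le hs (δ := dist u' u)
      (fun x => BoundedContinuousFunction.dist_coe_le_dist (f := u') (g := u) x) N x
    have h2 : u' x = u (x + 1) := rfl
    rw [Real.dist_eq, h2, hu0 (x + 1), hu0 x, ← mul_sub, abs_mul, abs_of_nonneg (by linarith)]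
    gcongr
  have hd0 : dist u' u = 0 := by
    have := dist_nonneg (x := u') (y := u)
    nlinarith
  have hper : ∀ k x, D.orb τ u k (x + 1) = D.orb τ u k x := by
    intro k x
    have h1 := hs.comp_add_one.abs_sub_le hs (δ := 0) (fun x => by
      rw [← hd0]
      exact BoundedContinuousFunction.dist_coe_le_dist (f := u') (g := u) x) k x
    exact sub_eq_zero.1 (abs_eq_zero.1 (le_antisymm h1 (abs_nonneg _)))
  exact ⟨fun k => D.orb τ u k, fun k => (D.orb τ u k).continuous, hper, hs, hu0⟩

end HamData

namespace HamData

variable {D : HamData}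

theorem IsScheme.le_along_line {τ : ℝ} (hτ : 0 < τ) {u : ℕ → ℝ → ℝ} (h : D.IsScheme τ u) {M : ℝ}
    (n : ℕ) (x v : ℝ) (j : ℕ)
    (hM : ∀ i : ℕ, i < j → D.L ((n + i + 1) * τ) (x + (i + 1) * τ * v) v ≤ M) :
    u (n + j) (x + j * τ * v) ≤ u n x + j * τ * M := by
  induction j with
  | zero => simp
  | succ j ih =>
    have h1 := ih fun i hi => hM i (by omega)
    have h2 := ((h (n + j)) (x + (j + 1) * τ * v)).1 (x + j * τ * v)
    have h3 : (x + (j + 1) * τ * v - (x + j * τ * v)) / τ = v := by field_simp; ring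
    have h4 := mul_le_mul_of_nonneg_left (hM j (by omega)) hτ.le
    rw [h3] at h2
    push_cast at h2 ⊢
    rw [← add_assoc]
    linarith

theorem IsScheme.exists_chain {τ : ℝ} {u : ℕ → ℝ → ℝ} (h : D.IsScheme τ u) (n : ℕ) :
    ∀ x, ∃ ξ : ℕ → ℝ, ξ n = x ∧ ∀ i < n, u (i + 1) (ξ (i + 1)) =
      u i (ξ i) + τ * D.L ((i + 1) * τ) (ξ (i + 1)) ((ξ (i + 1) - ξ i) / τ) := by
  induction n with
  | zero => exact fun x => ⟨fun _ => x, rfl, by simp⟩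
  | succ n ih =>
    intro x
    obtain ⟨y, hy⟩ := (h n x).2
    obtain ⟨ξ, hξ, hi⟩ := ih y
    refine ⟨Function.update ξ (n + 1) x, by simp, fun i hin => ?_⟩
    rcases Nat.lt_succ_iff_lt_or_eq.1 hin with h1 | rfl
    · rw [Function.update_of_ne (by omega), Function.update_of_ne (by omega)]
      exact hi i h1
    · rw [Function.update_self, Function.update_of_ne (by omega), hξ]
      exact hy

theorem hasDerivAt_action_right {τ : ℝ} (hτ : τ ≠ 0) (t a y : ℝ) :
    HasDerivAt (fun y => τ * D.L t y ((y - a) / τ))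
      (D.P t y ((y - a) / τ) - τ * D.Hx t y (D.P t y ((y - a) / τ))) y := by
  have h1 := (D.hasFDerivAt_L t y ((y - a) / τ)).comp_hasDerivAt y
    ((hasDerivAt_id y).prodMk (((hasDerivAt_id y).sub_const a).div_const τ))
  have h2 := h1.const_mul τ
  refine h2.congr_deriv ?_
  simp
  field_simp
  ring

theorem hasDerivAt_action_left {τ : ℝ} (hτ : τ ≠ 0) (t b y : ℝ) :
    HasDerivAt (fun y => τ * D.L t b ((b - y) / τ)) (-D.P t b ((b - y) / τ)) y := by
  have h1 := (D.hasFDerivAt_L t b ((b - y) / τ)).comp_hasDerivAt y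
    ((hasDerivAt_const y b).prodMk (((hasDerivAt_id y).const_sub b).div_const τ))
  have h2 := h1.const_mul τ
  refine h2.congr_deriv ?_
  simp
  field_simp

/-- The discrete Euler–Lagrange equation along minimizing chains. -/
theorem IsStep.euler_lagrange {τ t t' : ℝ} (hτ : 0 < τ) {u w z : ℝ → ℝ} (h : D.IsStep τ t u w)
    (h' : D.IsStep τ t' w z) {a y b : ℝ} (hy : w y = u a + τ * D.L t y ((y - a) / τ))
    (hb : z b = w y + τ * D.L t' b ((b - y) / τ)) :
    D.P t' b ((b - y) / τ) =
      D.P t y ((y - a) / τ) - τ * D.Hx t y (D.P t y ((y - a) / τ)) := by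
  have hd := (D.hasDerivAt_action_right hτ.ne' t a y).add (D.hasDerivAt_action_left hτ.ne' t' b y)
  have hm : IsLocalMin ((fun y => τ * D.L t y ((y - a) / τ)) +
      fun y => τ * D.L t' b ((b - y) / τ)) y := by
    refine Eventually.of_forall fun y' => ?_
    have h1 := (h y').1 a
    have h2 := (h' b).1 y'
    simp only [Pi.add_apply]
    linarith
  have := hm.hasDerivAt_eq_zero hd
  linarith

/-- Along a minimizing chain over a unit time interval, the velocity is somewhere bounded. -/
theorem IsScheme.exists_L_le {N : ℕ} (hN : 1 ≤ N) {u : ℕ → ℝ → ℝ}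
    (hper : ∀ k x, u k (x + 1) = u k x) (h : D.IsScheme (1 / N) u) {C : ℝ}
    (hC : ∀ t x v, |v| ≤ 1 → |D.L t x v| ≤ C) {n : ℕ} {ξ : ℕ → ℝ} {m : ℕ} (hm : m + N = n)
    (hξ : ∀ i < n, u (i + 1) (ξ (i + 1)) = u i (ξ i) +
      (1 / N : ℝ) * D.L ((i + 1) * (1 / N)) (ξ (i + 1)) ((ξ (i + 1) - ξ i) / (1 / N))) :
    ∃ i, m ≤ i ∧ i < n ∧
      D.L ((i + 1) * (1 / N)) (ξ (i + 1)) ((ξ (i + 1) - ξ i) / (1 / N)) ≤ C + 1 := by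
  have hN0 : (1 : ℝ) ≤ N := by exact_mod_cast hN
  have hτ : (0 : ℝ) < 1 / N := by positivity
  have hNτ : (N : ℝ) * (1 / N) = 1 := by field_simp
  set τ : ℝ := 1 / N
  by_contra! hcon
  have key : ∀ j ≤ N, u m (ξ m) + j * τ * (C + 1) ≤ u (m + j) (ξ (m + j)) := by
    intro j
    induction j with
    | zero => simp
    | succ j ih =>
      intro hj
      have h1 := ih (by omega)
      have h2 := hξ (m + j) (by omega)
      have h3 := mul_le_mul_of_nonneg_left (hcon (m + j) (by omega) (by omega)).le hτ.le
      rw [← add_assoc, h2]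
      push_cast at h3 ⊢
      linarith
  have h1 := key N le_rfl
  set v := Int.fract (ξ n - ξ m) with hv
  have hv0 : |v| ≤ 1 := by
    rw [abs_of_nonneg (Int.fract_nonneg _)]; exact (Int.fract_lt_one _).le
  have h2 := h.le_along_line hτ m (ξ n - v) v N fun i _ => (abs_le.mp (hC _ _ v hv0)).2
  rw [hNτ] at h1 h2
  have h3 : ξ n - v = ξ m + ⌊ξ n - ξ m⌋ := by
    have := Int.fract_add_floor (ξ n - ξ m)
    rw [hv]; linarith
  have h4 : u m (ξ n - v) = u m (ξ m) := by
    rw [h3]; exact periodic_add_int (hper m) _ _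
  rw [h4, one_mul, sub_add_cancel, hm] at h2
  rw [hm] at h1
  linarith

variable (D)

/-- Uniform Lipschitz bound in space after a unit time for the discrete scheme. -/
theorem exists_lipschitz : ∃ R : ℝ, 0 ≤ R ∧ ∃ N₀ : ℕ, 1 ≤ N₀ ∧ ∀ N : ℕ, N₀ ≤ N →
    ∀ u : ℕ → ℝ → ℝ, (∀ k, Continuous (u k)) → (∀ k x, u k (x + 1) = u k x) →
      D.IsScheme (1 / N) u → ∀ n, N ≤ n → ∀ x y, |u n x - u n y| ≤ R * |x - y| := by
  obtain ⟨C, hC0, hC⟩ := D.exists_L_bound 1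
  obtain ⟨B, hB0, hB⟩ := D.exists_coercive 1
  obtain ⟨P₀, hP0, hP⟩ := D.exists_P_bound (C + 1 + B)
  obtain ⟨ε, hε, R, hR⟩ := D.exists_orbit_bound P₀
  obtain ⟨CX, hCX0, hCX⟩ := exists_bound_of_periodic D.contDiffHx.continuous D.perHx_t D.perHx_x R
  obtain ⟨N₁, hN₁⟩ := exists_nat_gt (1 / ε)
  refine ⟨|R| + CX, by positivity, max N₁ 1, le_max_right _ _, ?_⟩
  intro N hN u hcont hper h n hn
  have hN1 : 1 ≤ N := (le_max_right _ _).trans hN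
  have hN0 : (1 : ℝ) ≤ N := by exact_mod_cast hN1
  have hτ : (0 : ℝ) < 1 / N := by positivity
  have hτ1 : (1 : ℝ) / N ≤ 1 := by rw [div_le_one (by positivity)]; exact hN0
  have hτε : (1 : ℝ) / N < ε := by
    rw [div_lt_comm₀ (by positivity) hε]
    refine hN₁.trans_le ?_
    exact_mod_cast (le_max_left _ _).trans hN
  have hNτ : (N : ℝ) * (1 / N) = 1 := by field_simp
  refine abs_sub_le_of_upper_support (hcont n) fun x => ?_
  obtain ⟨ξ, hξn, hξ⟩ := h.exists_chain n x
  obtain ⟨i, hmi, hin, hi⟩ := h.exists_L_le hN1 hper hC (m := n - N) (by omega) hξ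
  set τ : ℝ := 1 / N
  set w : ℕ → ℝ := fun i => (ξ (i + 1) - ξ i) / τ with hw
  have hwi : |w i| ≤ C + 1 + B := by
    have := hB ((i + 1) * τ) (ξ (i + 1)) (w i)
    linarith
  set p : ℕ → ℝ := fun j => D.P ((i + j + 1) * τ) (ξ (i + j + 1)) (w (i + j)) with hp
  have horb : D.IsOrbit τ ((i + 1) * τ) (n - 1 - i) (fun j => ξ (i + j + 1)) p := by
    intro j hj
    constructor
    · have h1 := (h (i + j)).euler_lagrange hτ (h (i + j + 1))
        (hξ (i + j) (by omega)) (hξ (i + j + 1) (by omega))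
      simp only [hp, hw]
      push_cast at h1 ⊢
      rw [show (i + 1 : ℝ) * τ + j * τ = (i + j + 1) * τ by ring,
        show (i : ℝ) + (j + 1) + 1 = i + j + 1 + 1 by ring]
      exact h1
    · simp only [hp]
      push_cast
      rw [show (i + 1 : ℝ) * τ + (j + 1) * τ = (i + (j + 1) + 1) * τ by ring, D.HpP]
      simp only [hw]
      rw [mul_div_cancel₀ _ hτ.ne', show i + (j + 1) = i + j + 1 by ring]
      ring
  have hJ : ((n - 1 - i : ℕ) : ℝ) * τ ≤ 1 := by
    rw [← hNτ]
    gcongr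
    omega
  have hbd := hR τ hτ hτε _ _ _ p (hP _ _ _ (by simpa using hwi)) hJ horb (n - 1 - i) le_rfl
  obtain ⟨k, rfl⟩ : ∃ k, n = k + 1 := ⟨n - 1, by omega⟩
  have hk : p (k + 1 - 1 - i) = D.P ((k + 1) * τ) x ((x - ξ k) / τ) := by
    have e : i + (k + 1 - 1 - i) = k := by omega
    have e' : (i : ℝ) + ((k + 1 - 1 - i : ℕ) : ℝ) = k := by exact_mod_cast e
    simp only [hp, hw, e, e', hξn]
  rw [hk] at hbd
  refine ⟨_, _, ?_, D.hasDerivAt_action_right hτ.ne' ((k + 1) * τ) (ξ k) x, fun y => ?_⟩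
  · refine (abs_sub _ _).trans ?_
    rw [abs_mul, abs_of_pos hτ]
    have h1 := hCX ((k + 1) * τ) x _ hbd
    have h2 : τ * |D.Hx ((k + 1) * τ) x (D.P ((k + 1) * τ) x ((x - ξ k) / τ))| ≤ 1 * CX := by
      gcongr
    have := le_abs_self R
    linarith
  · have h1 := (h k y).1 (ξ k)
    have h2 := hξ k (by omega)
    rw [hξn] at h2
    linarith

end HamData

theorem abs_sub_le_of_periodic {f : ℝ → ℝ} (hper : ∀ x, f (x + 1) = f x) {R : ℝ} (hR : 0 ≤ R)
    (hf : ∀ x y, |f x - f y| ≤ R * |x - y|) (x y : ℝ) : |f x - f y| ≤ R := by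
  have h1 : f (y + Int.fract (x - y)) = f x := by
    rw [← periodic_add_int hper _ ⌊x - y⌋, add_assoc, Int.fract_add_floor, add_sub_cancel]
  rw [← h1]
  refine (hf _ _).trans (mul_le_of_le_one_right hR ?_)
  rw [add_sub_cancel_left, abs_of_nonneg (Int.fract_nonneg _)]
  exact (Int.fract_lt_one _).le

namespace HamData

variable {D : HamData}

theorem IsScheme.add_const {τ : ℝ} {u : ℕ → ℝ → ℝ} (h : D.IsScheme τ u) (b : ℝ) :
    D.IsScheme τ fun k x => u k x + b := by
  intro k x
  obtain ⟨h1, y, hy⟩ := h k x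
  exact ⟨fun z => by linarith [h1 z], y, by linarith⟩

theorem abs_sub_le_of_step {τ : ℝ} {u : ℕ → ℝ → ℝ} {C : ℝ}
    (h : ∀ k x, |u (k + 1) x - u k x| ≤ C * τ) (n j : ℕ) (x : ℝ) :
    |u (n + j) x - u n x| ≤ C * (j * τ) := by
  induction j with
  | zero => simp
  | succ j ih =>
    have h1 := abs_le.mp (h (n + j) x)
    have h2 := abs_le.mp ih
    rw [← add_assoc, abs_le]
    push_cast
    constructor <;> linarith [h1.1, h1.2, h2.1, h2.2]

variable (D)

/-- Solutions of the discrete scheme which are almost periodic in time up to a drift, with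
estimates uniform in the step of the scheme. -/
theorem exists_almost_periodic : ∃ R K C : ℝ, 0 ≤ R ∧ 0 ≤ K ∧ 0 ≤ C ∧ ∃ N₀ : ℕ, 1 ≤ N₀ ∧
    ∀ N : ℕ, N₀ ≤ N → ∃ (w : ℕ → ℝ → ℝ) (a : ℝ), |a| ≤ C ∧ D.IsScheme (1 / N) w ∧
      (∀ k x, w k (x + 1) = w k x) ∧ (∀ k x y, |w k x - w k y| ≤ R * |x - y|) ∧
      (∀ k x, |w (k + 1) x - w k x| ≤ C * (1 / N)) ∧
      (∀ (k : ℕ) (x y : ℝ), w (k + 1) x = w k y +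
        (1 / N : ℝ) * D.L ((k + 1) * (1 / N)) x ((x - y) / (1 / N)) → |x - y| ≤ K * (1 / N)) ∧
      ∀ k x, |w (N + k) x - w k x + a| ≤ R * (1 / N) := by
  obtain ⟨R, hR0, N₀, hN₀, hlip⟩ := D.exists_lipschitz
  obtain ⟨C, hC0, hC⟩ := D.exists_L_bound 0
  obtain ⟨B, hB0, hB⟩ := D.exists_coercive (R + 1)
  refine ⟨R, C + B, C + B + R, hR0, by positivity, by positivity, N₀, hN₀, fun N hN => ?_⟩
  have hN1 : 1 ≤ N := hN₀.trans hN
  have hN0 : (1 : ℝ) ≤ N := by exact_mod_cast hN1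
  have hτ : (0 : ℝ) < 1 / N := by positivity
  have hτ1 : (1 : ℝ) / N ≤ 1 := by rw [div_le_one (by positivity)]; exact hN0
  have hNτ : (N : ℝ) * (1 / N) = 1 := by field_simp
  obtain ⟨u, hcont, hper, hs, hu0⟩ := D.exists_discounted hN1
  have hl := hlip N hN u hcont hper hs
  set τ : ℝ := 1 / N
  have hwl : ∀ k x y, |u (N + k) x - u (N + k) y| ≤ R * |x - y| := fun k =>
    hl (N + k) (by omega)
  have hws := hs.shift_period hNτ
  have hup : ∀ k x, u (N + (k + 1)) x ≤ u (N + k) x + τ * C := by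
    intro k x
    have h1 := (hws k x).1 x
    have h2 : τ * D.L ((k + 1) * τ) x ((x - x) / τ) ≤ τ * C := by
      gcongr
      exact (abs_le.mp (hC _ _ _ (by simp))).2
    linarith
  have hlow : ∀ k x y, τ * ((R + 1) * |(x - y) / τ| - B) ≤
      τ * D.L ((k + 1) * τ) x ((x - y) / τ) := fun k x y => by
    gcongr; exact hB _ _ _
  have hlow' : ∀ k x y, (R + 1) * |x - y| - τ * B ≤ τ * D.L ((k + 1) * τ) x ((x - y) / τ) := by
    intro k x y
    refine le_trans (le_of_eq ?_) (hlow k x y)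
    rw [abs_div, abs_of_pos hτ]
    field_simp
  have htime : ∀ k x, |u (N + (k + 1)) x - u (N + k) x| ≤ (C + B) * τ := by
    intro k x
    have h1 := hup k x
    obtain ⟨y, hy⟩ := (hws k x).2
    simp only at hy
    have h2 := hlow' k x y
    have h3 := (abs_le.mp (hwl k x y)).2
    have h4 := abs_nonneg (x - y)
    rw [abs_le]
    constructor <;> nlinarith
  have hvel : ∀ (k : ℕ) (x y : ℝ), u (N + (k + 1)) x = u (N + k) y +
      τ * D.L ((k + 1) * τ) x ((x - y) / τ) → |x - y| ≤ (C + B) * τ := by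
    intro k x y hy
    have h1 := hup k x
    have h2 := hlow' k x y
    have h3 := (abs_le.mp (hwl k x y)).2
    linarith
  have hdrift : ∀ k x, |u (N + k) x - (u k x + τ * u N 0)| ≤ R * τ := by
    refine fun k x => hws.abs_sub_le (hs.add_const (τ * u N 0)) (fun x => ?_) k x
    have h1 := abs_sub_le_of_periodic (hper N) hR0 (hl N le_rfl) x 0
    rw [hu0 x, show u (N + 0) x - ((1 - τ) * u N x + τ * u N 0) = τ * (u N x - u N 0) by
      rw [add_zero]; ring, abs_mul, abs_of_pos hτ, mul_comm]
    gcongr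
  refine ⟨fun k => u (N + k), -(τ * u N 0), ?_, hws, fun k => hper _, hwl, fun k x => ?_, hvel,
    fun k x => ?_⟩
  · have h1 := abs_le.mp (hdrift (N + 0) 0)
    have h2 := abs_le.mp (abs_sub_le_of_step (u := fun k => u (N + k)) htime 0 N 0)
    rw [hNτ] at h2
    have h3 : R * τ ≤ R := mul_le_of_le_one_right hR0 hτ1
    simp only [add_zero, zero_add] at h1 h2
    rw [abs_le]
    constructor <;> linarith [h1.1, h1.2, h2.1, h2.2]
  · exact (htime k x).trans (mul_le_mul_of_nonneg_right (by linarith) hτ.le)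
  · refine le_trans (le_of_eq ?_) (hdrift (N + k) x)
    congr 1
    ring

variable {D}

/-- The index of the discrete time preceding `t`, when the scheme starts at time `-N`. -/
noncomputable def idx (N : ℕ) (t : ℝ) : ℕ := ⌊N * (t + N)⌋₊

theorem idx_mul_le {N : ℕ} (hN : 1 ≤ N) {t : ℝ} (ht : -(N : ℝ) ≤ t) :
    (idx N t : ℝ) * (1 / N) ≤ t + N := by
  have hN0 : (0 : ℝ) < N := by exact_mod_cast hN
  have := Nat.floor_le (a := N * (t + N)) (mul_nonneg hN0.le (by linarith))
  rw [mul_one_div, div_le_iff₀ hN0, mul_comm (t + N)]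
  exact this

theorem lt_idx_mul {N : ℕ} (hN : 1 ≤ N) (t : ℝ) : t + N < (idx N t + 1) * (1 / N) := by
  have hN0 : (0 : ℝ) < N := by exact_mod_cast hN
  have := Nat.lt_floor_add_one ((N : ℝ) * (t + N))
  rw [mul_one_div, lt_div_iff₀ hN0, mul_comm (t + N)]
  exact this

theorem idx_add_one {N : ℕ} {t : ℝ} (ht : -(N : ℝ) ≤ t) : idx N (t + 1) = N + idx N t := by
  have h0 : (0 : ℝ) ≤ N * (t + N) := mul_nonneg (Nat.cast_nonneg N) (by linarith)
  rw [idx, show (N : ℝ) * (t + 1 + N) = N * (t + N) + N by ring, Nat.floor_add_natCast h0, idx,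
    add_comm]

theorem idx_mono {N : ℕ} {s t : ℝ} (h : s ≤ t) : idx N s ≤ idx N t := by
  unfold idx; gcongr

theorem IsScheme.idx_le {N : ℕ} (hN : 1 ≤ N) {u : ℕ → ℝ → ℝ} (hu : D.IsScheme (1 / N) u)
    {t h : ℝ} (hh : 0 < h) (ht : -(N : ℝ) ≤ t - h) {x v M : ℝ}
    (hM : ∀ r ∈ Icc (t - h) t, ∀ y, |y - x| ≤ (h + 1 / N) * |v| → D.L r y v ≤ M) :
    ∃ s, |s - h| ≤ 1 / N ∧ u (idx N t) x ≤ u (idx N (t - h)) (x - s * v) + s * M := by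
  have hN0 : (0 : ℝ) < N := by exact_mod_cast hN
  have hτ : (0 : ℝ) < 1 / N := by positivity
  have a1 := idx_mul_le hN (t := t) (by linarith)
  have a2 := lt_idx_mul hN t
  have b1 := idx_mul_le hN ht
  have b2 := lt_idx_mul hN (t - h)
  obtain ⟨j, hj⟩ := Nat.exists_eq_add_of_le (idx_mono (N := N) (show t - h ≤ t by linarith))
  set n := idx N (t - h)
  set τ : ℝ := 1 / N
  rw [hj] at a1 a2 ⊢
  push_cast at a1 a2
  have hs : |j * τ - h| ≤ τ := by rw [abs_le]; constructor <;> linarith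
  refine ⟨j * τ, hs, ?_⟩
  have := hu.le_along_line hτ (M := M) n (x - j * τ * v) v j fun i hi => by
    have hi' : (i : ℝ) + 1 ≤ j := by exact_mod_cast hi
    have hi2 : ((i : ℝ) + 1) * τ ≤ j * τ := by gcongr
    have hi3 : 0 ≤ (i : ℝ) * τ := by positivity
    have e := periodic_add_int (g := fun r => D.L r (x - j * τ * v + (i + 1) * τ * v) v)
      (fun r => D.perL_t r _ _) ((n + i + 1) * τ - N) N
    simp only [Int.cast_natCast, sub_add_cancel] at e
    rw [e]
    refine hM _ ⟨by linarith, by linarith⟩ _ ?_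
    rw [show x - j * τ * v + (i + 1) * τ * v - x = -((j * τ - (i + 1) * τ) * v) by ring, abs_neg,
      abs_mul, abs_of_nonneg (by linarith)]
    have := (abs_le.mp hs).2
    gcongr
    linarith
  rwa [sub_add_cancel] at this

theorem IsScheme.le_idx {N : ℕ} (hN : 1 ≤ N) {u : ℕ → ℝ → ℝ} (hu : D.IsScheme (1 / N) u)
    {K : ℝ} (hK0 : 0 ≤ K) (hK : ∀ (k : ℕ) (x y : ℝ), u (k + 1) x = u k y +
        (1 / N : ℝ) * D.L ((k + 1) * (1 / N)) x ((x - y) / (1 / N)) → |x - y| ≤ K * (1 / N))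
    {t h : ℝ} (hh : 0 < h) (ht : -(N : ℝ) ≤ t - h) {x p M : ℝ}
    (hM : ∀ r ∈ Icc (t - h) t, ∀ y, |y - x| ≤ K * (h + 1 / N) → D.H r y p ≤ M) :
    ∃ s y, |s - h| ≤ 1 / N ∧ |y - x| ≤ K * (h + 1 / N) ∧
      u (idx N (t - h)) y + p * (x - y) - s * M ≤ u (idx N t) x := by
  have hN0 : (0 : ℝ) < N := by exact_mod_cast hN
  have hτ : (0 : ℝ) < 1 / N := by positivity
  have a1 := idx_mul_le hN (t := t) (by linarith)
  have a2 := lt_idx_mul hN t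
  have b1 := idx_mul_le hN ht
  have b2 := lt_idx_mul hN (t - h)
  obtain ⟨j, hj⟩ := Nat.exists_eq_add_of_le (idx_mono (N := N) (show t - h ≤ t by linarith))
  set n := idx N (t - h)
  rw [hj] at a1 a2 ⊢
  push_cast at a1 a2
  obtain ⟨ξ, hξ, hchain⟩ := hu.exists_chain (n + j) x
  set τ : ℝ := 1 / N
  have hs : |j * τ - h| ≤ τ := by rw [abs_le]; constructor <;> linarith
  have hdist : ∀ i ≤ j, |ξ (n + (j - i)) - x| ≤ K * (i * τ) := by
    intro i
    induction i with
    | zero => simp [hξ]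
    | succ i ih =>
      intro hi
      have h1 := ih (by omega)
      have h2 := hK _ _ _ (hchain (n + (j - (i + 1))) (by omega))
      rw [show n + (j - (i + 1)) + 1 = n + (j - i) by omega] at h2
      have h3 := abs_le.mp h1
      have h4 := abs_le.mp h2
      push_cast
      rw [abs_le]
      constructor <;> linarith [h3.1, h3.2, h4.1, h4.2]
  have hdist' : ∀ i ≤ j, |ξ (n + i) - x| ≤ K * (h + τ) := by
    intro i hi
    have h1 := hdist (j - i) (by omega)
    rw [show j - (j - i) = i by omega] at h1
    refine h1.trans ?_
    have h2 : ((j - i : ℕ) : ℝ) * τ ≤ j * τ := by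
      gcongr; omega
    have := (abs_le.mp hs).2
    gcongr
    linarith
  have hsum : ∀ i ≤ j, u n (ξ n) + p * (ξ (n + i) - ξ n) - i * τ * M ≤ u (n + i) (ξ (n + i)) := by
    intro i
    induction i with
    | zero => simp
    | succ i ih =>
      intro hi
      have h1 := ih (by omega)
      have h2 := hchain (n + i) (by omega)
      rw [← add_assoc, h2]
      have hi' : (i : ℝ) + 1 ≤ j := by exact_mod_cast hi
      have hi2 : ((i : ℝ) + 1) * τ ≤ j * τ := by gcongr
      have hi3 : 0 ≤ (i : ℝ) * τ := by positivity
      have e := periodic_add_int (g := fun r => D.H r (ξ (n + i + 1)) p)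
        (fun r => D.perH_t r _ _) ((n + i + 1) * τ - N) N
      simp only [Int.cast_natCast, sub_add_cancel] at e
      have h3 : D.H ((n + i + 1) * τ) (ξ (n + i + 1)) p ≤ M := by
        rw [e]
        exact hM _ ⟨by linarith, by linarith⟩ _ (hdist' (i + 1) hi)
      have h4 := D.le_L ((n + i + 1) * τ) (ξ (n + i + 1)) ((ξ (n + i + 1) - ξ (n + i)) / τ) p
      have h5 : τ * (p * ((ξ (n + i + 1) - ξ (n + i)) / τ) - M) ≤
          τ * D.L ((n + i + 1) * τ) (ξ (n + i + 1)) ((ξ (n + i + 1) - ξ (n + i)) / τ) := by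
        gcongr; linarith
      have h6 : τ * (p * ((ξ (n + i + 1) - ξ (n + i)) / τ) - M) =
          p * (ξ (n + i + 1) - ξ (n + i)) - τ * M := by field_simp
      push_cast
      linarith
  refine ⟨j * τ, ξ n, hs, by simpa using hdist' 0 (by omega), ?_⟩
  have := hsum j le_rfl
  rwa [hξ] at this

/-- Lipschitz estimate in both variables for the interpolated scheme. -/
theorem abs_idx_sub_le {N : ℕ} (hN : 1 ≤ N) {u : ℕ → ℝ → ℝ} {R C : ℝ} (hC0 : 0 ≤ C)
    (hR : ∀ k x y, |u k x - u k y| ≤ R * |x - y|)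
    (hC : ∀ k x, |u (k + 1) x - u k x| ≤ C * (1 / N)) {s t : ℝ} (hs : -(N : ℝ) ≤ s)
    (ht : -(N : ℝ) ≤ t) (x y : ℝ) :
    |u (idx N t) x - u (idx N s) y| ≤ R * |x - y| + C * (|t - s| + 1 / N) := by
  wlog hst : s ≤ t generalizing s t x y
  · have := this ht hs y x (by linarith)
    rwa [abs_sub_comm, abs_sub_comm x, abs_sub_comm t]
  have a1 := idx_mul_le hN ht
  have b2 := lt_idx_mul hN s
  obtain ⟨j, hj⟩ := Nat.exists_eq_add_of_le (idx_mono (N := N) hst)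
  rw [hj] at a1 ⊢
  push_cast at a1
  have h1 := abs_le.mp (abs_sub_le_of_step hC (idx N s) j x)
  have h2 := abs_le.mp (hR (idx N s) x y)
  have h3 : C * (j * (1 / N)) ≤ C * (|t - s| + 1 / N) := by
    gcongr
    linarith [le_abs_self (t - s)]
  rw [abs_le]
  constructor <;> linarith [h1.1, h1.2, h2.1, h2.2]

end HamData

theorem exists_tendsto_hyperfilter {f : ℕ → ℝ} {b : ℝ} (h : ∀ᶠ n in atTop, |f n| ≤ b) :
    ∃ l, Tendsto f (hyperfilter ℕ : Filter ℕ) (𝓝 l) := by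
  have h1 : ∀ᶠ n in (hyperfilter ℕ : Filter ℕ), f n ∈ Icc (-b) b :=
    Nat.hyperfilter_le_atTop (h.mono fun n hn => abs_le.mp hn)
  obtain ⟨l, -, hl⟩ := (isCompact_Icc (a := -b) (b := b)).ultrafilter_le_nhds
    ((hyperfilter ℕ).map f) (le_principal_iff.2 h1)
  exact ⟨l, hl⟩

namespace HamData

variable (D : HamData)

/-- Limit of the discrete scheme: a Lipschitz function, periodic up to a drift, satisfying local
forms of the dynamic programming principle. -/
theorem exists_continuous_limit : ∃ (U : ℝ → ℝ → ℝ) (a K : ℝ), 0 ≤ K ∧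
    Continuous (fun z : ℝ × ℝ => U z.1 z.2) ∧ (∀ t x, U t (x + 1) = U t x) ∧
    (∀ t x, U (t + 1) x = U t x - a) ∧
    (∀ t x h v M, 0 < h → (∀ r ∈ Icc (t - h) t, ∀ y, |y - x| ≤ 2 * h * |v| → D.L r y v ≤ M) →
      U t x ≤ U (t - h) (x - h * v) + h * M) ∧
    ∀ t x h p M, 0 < h → (∀ r ∈ Icc (t - h) t, ∀ y, |y - x| ≤ K * (2 * h) → D.H r y p ≤ M) →
      ∃ y, |y - x| ≤ K * (2 * h) ∧ U (t - h) y + p * (x - y) - h * M ≤ U t x := by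
  obtain ⟨R, K, C, hR0, hK0, hC0, N₀, hN₀, hseq⟩ := D.exists_almost_periodic
  choose! w a ha hs hper hlip htime hvel hdrift using hseq
  set 𝓤 : Filter ℕ := ((hyperfilter ℕ : Ultrafilter ℕ) : Filter ℕ)
  have hle : 𝓤 ≤ atTop := Nat.hyperfilter_le_atTop
  have hinv : Tendsto (fun N : ℕ => (1 : ℝ) / N) 𝓤 (𝓝 0) :=
    tendsto_one_div_atTop_nhds_zero_nat.mono_left hle
  have hev : ∀ t : ℝ, ∀ᶠ N : ℕ in atTop, N₀ ≤ N ∧ -(N : ℝ) ≤ t := fun t => by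
    filter_upwards [eventually_ge_atTop N₀,
      tendsto_natCast_atTop_atTop.eventually_ge_atTop (-t)] with N h1 h2
    exact ⟨h1, by linarith⟩
  set V : ℕ → ℝ → ℝ → ℝ := fun N t x => w N (idx N t) x - w N (idx N 0) 0 with hV
  have hVlip : ∀ s t : ℝ, ∀ᶠ N : ℕ in atTop, ∀ x y,
      |V N t x - V N s y| ≤ R * |x - y| + C * (|t - s| + 1 / N) := by
    intro s t
    filter_upwards [hev s, hev t] with N h1 h2 x y
    simp only [hV, sub_sub_sub_cancel_right]
    exact abs_idx_sub_le (hN₀.trans h1.1) hC0 (hlip N h1.1) (htime N h1.1) h1.2 h2.2 x y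
  have hVb : ∀ t x, ∀ᶠ N : ℕ in atTop, |V N t x| ≤ R * |x - 0| + C * (|t - 0| + 1) := by
    intro t x
    filter_upwards [hVlip 0 t, hev 0] with N h1 h2
    have h3 := h1 x 0
    have h4 : V N 0 0 = 0 := by simp [hV]
    rw [h4, sub_zero] at h3
    refine h3.trans ?_
    have hN0 : (1 : ℝ) ≤ N := by exact_mod_cast hN₀.trans h2.1
    have : (1 : ℝ) / N ≤ 1 := by rw [div_le_one (by positivity)]; exact hN0
    gcongr
  choose U hU using fun t x => exists_tendsto_hyperfilter (hVb t x)
  obtain ⟨a₀, ha₀⟩ := exists_tendsto_hyperfilter (f := a) (b := C)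
    ((eventually_ge_atTop N₀).mono fun N hN => ha N hN)
  have hUlip : ∀ t s x y, |U t x - U s y| ≤ R * |x - y| + C * |t - s| := by
    intro t s x y
    have h1 : Tendsto (fun N : ℕ => R * |x - y| + C * (|t - s| + 1 / N)) 𝓤
        (𝓝 (R * |x - y| + C * (|t - s| + 0))) :=
      ((hinv.const_add _).const_mul _).const_add _
    rw [add_zero] at h1
    exact le_of_tendsto_of_tendsto ((hU t x).sub (hU s y)).abs h1
      (hle ((hVlip s t).mono fun N hN => hN x y))
  refine ⟨U, a₀, K, hK0, ?_, fun t x => ?_, fun t x => ?_, ?_, ?_⟩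
  · rw [continuous_iff_continuousAt]
    rintro ⟨t, x⟩
    rw [ContinuousAt, tendsto_iff_dist_tendsto_zero]
    refine squeeze_zero (fun _ => dist_nonneg) (fun z => hUlip z.1 t z.2 x) ?_
    have : Continuous fun z : ℝ × ℝ => R * |z.2 - x| + C * |z.1 - t| := by fun_prop
    simpa using this.tendsto (t, x)
  · refine tendsto_nhds_unique_of_eventuallyEq (hU t (x + 1)) (hU t x) (hle ?_)
    filter_upwards [hev t] with N hN
    simp only [hV, hper N hN.1]
  · have h1 : Tendsto (fun N => V N (t + 1) x - V N t x + a N) 𝓤 (𝓝 0) := by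
      refine squeeze_zero_norm' (a := fun N : ℕ => R * ((1 : ℝ) / N)) (hle ?_)
        (by simpa using hinv.const_mul R)
      filter_upwards [hev t] with N hN
      simp only [hV, sub_sub_sub_cancel_right]
      rw [idx_add_one hN.2]
      exact hdrift N hN.1 _ x
    have h2 := tendsto_nhds_unique h1 (((hU (t + 1) x).sub (hU t x)).add ha₀)
    linarith
  · intro t x h v M hh hM
    have h1 : Tendsto (fun N : ℕ => V N (t - h) (x - h * v) +
        ((1 : ℝ) / N * (R * |v| + |M|) + h * M)) 𝓤
        (𝓝 (U (t - h) (x - h * v) + (0 * (R * |v| + |M|) + h * M))) :=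
      (hU _ _).add ((hinv.mul_const _).add_const _)
    rw [zero_mul, zero_add] at h1
    refine le_of_tendsto_of_tendsto (hU t x) h1 ?_
    filter_upwards [hle (hev (t - h)), hinv.eventually_le_const hh] with N hN hNh
    obtain ⟨s, hs1, hs2⟩ := (hs N hN.1).idx_le (hN₀.trans hN.1) hh hN.2 (x := x) (v := v) (M := M)
      fun r hr y hy => hM r hr y (hy.trans (by gcongr; linarith))
    have h3 := (abs_le.mp (hlip N hN.1 (idx N (t - h)) (x - s * v) (x - h * v))).2
    have h4 : |x - s * v - (x - h * v)| ≤ 1 / N * |v| := by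
      rw [show x - s * v - (x - h * v) = -((s - h) * v) by ring, abs_neg, abs_mul]
      gcongr
    have h5 : (s - h) * M ≤ 1 / N * |M| := by
      refine (le_abs_self _).trans ?_
      rw [abs_mul]
      gcongr
    have h6 := mul_le_mul_of_nonneg_left h4 hR0
    simp only [hV]
    linarith
  · intro t x h p M hh hM
    have hex : ∀ᶠ N : ℕ in 𝓤, ∃ y, |y - x| ≤ K * (2 * h) ∧
        V N (t - h) y + p * (x - y) - h * M - 1 / N * |M| ≤ V N t x := by
      filter_upwards [hle (hev (t - h)), hinv.eventually_le_const hh] with N hN hNh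
      have hK2 : K * (h + 1 / N) ≤ K * (2 * h) := by gcongr; linarith
      obtain ⟨s, y, hs1, hy, hs2⟩ := (hs N hN.1).le_idx (hN₀.trans hN.1) hK0 (hvel N hN.1) hh
        hN.2 (x := x) (p := p) (M := M) fun r hr y hy => hM r hr y (hy.trans hK2)
      refine ⟨y, hy.trans hK2, ?_⟩
      have h5 : (s - h) * M ≤ 1 / N * |M| := by
        refine (le_abs_self _).trans ?_
        rw [abs_mul]
        gcongr
      simp only [hV]
      linarith
    obtain ⟨y, hy⟩ := hex.choice
    obtain ⟨y₀, -, hy₀'⟩ := (isCompact_closedBall x (K * (2 * h))).ultrafilter_le_nhds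
      ((hyperfilter ℕ).map y) (le_principal_iff.2 (hy.mono fun N hN => hN.1))
    have hy₀ : Tendsto y 𝓤 (𝓝 y₀) := hy₀'
    refine ⟨y₀, le_of_tendsto (hy₀.sub_const x).abs (hy.mono fun N hN => hN.1), ?_⟩
    have h1 : Tendsto (fun N : ℕ => V N (t - h) y₀ - R * |y N - y₀| + p * (x - y N) - h * M -
        1 / N * |M|) 𝓤
        (𝓝 (U (t - h) y₀ - R * |y₀ - y₀| + p * (x - y₀) - h * M - 0 * |M|)) :=
      (((((hU _ _).sub ((hy₀.sub_const y₀).abs.const_mul R)).add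
        ((hy₀.const_sub x).const_mul p)).sub_const _).sub (hinv.mul_const _))
    rw [sub_self, abs_zero, mul_zero, zero_mul, sub_zero, sub_zero] at h1
    refine le_of_tendsto_of_tendsto h1 (hU t x) ?_
    filter_upwards [hle (hev (t - h)), hy] with N hN hyN
    have h3 := (abs_le.mp (hlip N hN.1 (idx N (t - h)) (y N) y₀)).1
    have h4 := hyN.2
    simp only [hV] at h4 ⊢
    linarith

end HamData

theorem fderiv_prod_apply (φ : ℝ × ℝ → ℝ) (z : ℝ × ℝ) (r y : ℝ) :
    fderiv ℝ φ z (r, y) = r * fderiv ℝ φ z (1, 0) + y * fderiv ℝ φ z (0, 1) := by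
  have : ((r, y) : ℝ × ℝ) = r • ((1 : ℝ), (0 : ℝ)) + y • ((0 : ℝ), (1 : ℝ)) := by simp
  rw [this, map_add, map_smul, map_smul, smul_eq_mul, smul_eq_mul]

theorem exists_backward_box {Q : ℝ × ℝ → Prop} {t x : ℝ} (hQ : ∀ᶠ w in 𝓝 (t, x), Q w) {K : ℝ}
    (hK : 0 ≤ K) :
    ∃ h > 0, ∀ r ∈ Icc (t - h) t, ∀ y, |y - x| ≤ K * (2 * h) → Q (r, y) := by
  obtain ⟨ε, hε, hb⟩ := Metric.eventually_nhds_iff.1 hQ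
  have hK1 : 0 < 2 * K + 1 := by linarith
  have e : (2 * K + 1) * (ε / (2 * (2 * K + 1))) = ε / 2 := by field_simp
  have hpos : 0 < ε / (2 * (2 * K + 1)) := by positivity
  set h := ε / (2 * (2 * K + 1))
  have hKh : 0 ≤ K * h := by positivity
  refine ⟨h, hpos, fun r hr y hy => hb ?_⟩
  rw [Prod.dist_eq, max_lt_iff, Real.dist_eq, Real.dist_eq]
  refine ⟨?_, by linarith⟩
  rw [abs_lt]
  constructor <;> linarith [hr.1, hr.2]

theorem eventually_sub_le_of_differentiableAt {φ : ℝ × ℝ → ℝ} {t x : ℝ}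
    (hφ : DifferentiableAt ℝ φ (t, x)) {K ε : ℝ} (hK : 0 ≤ K) (hε : 0 < ε) :
    ∀ᶠ w in 𝓝 (t, x), ∀ h, |w.1 - t| ≤ h → |w.2 - x| ≤ K * (2 * h) →
      |φ w - φ (t, x) - ((w.1 - t) * fderiv ℝ φ (t, x) (1, 0) +
        (w.2 - x) * fderiv ℝ φ (t, x) (0, 1))| ≤ ε * h := by
  have hc : 0 < ε / (2 * K + 1) := by positivity
  filter_upwards [hφ.hasFDerivAt.isLittleO.bound hc] with w hw h h1 h2
  have hh : 0 ≤ h := (abs_nonneg _).trans h1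
  have e := fderiv_prod_apply φ (t, x) (w.1 - t) (w.2 - x)
  rw [← e]
  refine hw.trans ?_
  have h3 : ‖w - (t, x)‖ ≤ (2 * K + 1) * h := by
    have : 0 ≤ K * h := by positivity
    rw [Prod.norm_def, max_le_iff]
    exact ⟨by simp only [Prod.fst_sub, Real.norm_eq_abs]; linarith,
      by simp only [Prod.snd_sub, Real.norm_eq_abs]; linarith⟩
  calc ε / (2 * K + 1) * ‖w - (t, x)‖ ≤ ε / (2 * K + 1) * ((2 * K + 1) * h) := by gcongr
    _ = ε * h := by field_simp

/-- For each `c` there is some `a` such that the Hamilton–Jacobi equation has a viscosity solution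
which is `1`-periodic in time. -/
theorem BurgersHyp.exists_periodic_viscSol {H : ℝ → ℝ → ℝ → ℝ} (hH : BurgersHyp H) (c : ℝ) :
    ∃ (a : ℝ) (v : ℝ → ℝ → ℝ), Continuous (fun z : ℝ × ℝ => v z.1 z.2) ∧
      (∀ θ x, v (θ + 1) x = v θ x) ∧ (∀ θ x, v θ (x + 1) = v θ x) ∧ ViscSol H c a univ v := by
  obtain ⟨D, hD⟩ := hH.exists_hamData c
  obtain ⟨U, a, K, hK, hc, hx, ht, hsub, hsup⟩ := D.exists_continuous_limit
  refine ⟨a, fun t x => U t x + a * t, hc.add (by fun_prop), fun t x => ?_, fun t x => ?_, ?_, ?_⟩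
  · simp only [ht]; ring
  · simp only [hx]
  · rintro φ hφ ⟨t, x⟩ - hmax
    have hd := (hφ.differentiable one_ne_zero).differentiableAt (x := (t, x))
    rw [← hD]
    simp only
    set p := fderiv ℝ φ (t, x) (0, 1)
    set q := fderiv ℝ φ (t, x) (1, 0)
    set v := D.Hp t x p
    refine le_of_forall_pos_le_add fun ε hε => ?_
    have hL : ∀ᶠ w in 𝓝 (t, x), D.L w.1 w.2 v < D.L t x v + ε / 2 := by
      have h1 : Continuous fun w : ℝ × ℝ => D.L w.1 w.2 v :=
        D.continuous_L.comp (continuous_fst.prodMk (continuous_snd.prodMk continuous_const))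
      exact h1.continuousAt.eventually_lt_const (by simp only; linarith)
    obtain ⟨h, hh, hbox⟩ := exists_backward_box (hmax.and (hL.and
      (eventually_sub_le_of_differentiableAt hd (abs_nonneg v) (half_pos hε)))) (abs_nonneg v)
    have h1 := hsub t x h v (D.L t x v + ε / 2) hh fun r hr y hy =>
      (hbox r hr y (by linarith)).2.1.le
    have hy : |x - h * v - x| ≤ |v| * (2 * h) := by
      rw [sub_sub_cancel_left, abs_neg, abs_mul, abs_of_pos hh]
      nlinarith [abs_nonneg v]
    obtain ⟨h2, -, h3⟩ := hbox (t - h) ⟨le_rfl, by linarith⟩ (x - h * v) hy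
    have h4 := (abs_le.mp (h3 h (by simp [abs_of_pos hh]) hy)).2
    simp only at h2 h4
    rw [D.L_Hp] at h1
    have h5 : h * (q + D.H t x p) ≤ h * (a + ε) := by
      simp only [v] at h1 h2 h4 ⊢
      linarith
    exact le_of_mul_le_mul_left h5 hh
  · rintro φ hφ ⟨t, x⟩ - hmin
    have hd := (hφ.differentiable one_ne_zero).differentiableAt (x := (t, x))
    rw [← hD]
    simp only
    set p := fderiv ℝ φ (t, x) (0, 1)
    set q := fderiv ℝ φ (t, x) (1, 0)
    refine le_of_forall_pos_le_add fun ε hε => ?_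
    have hH' : ∀ᶠ w in 𝓝 (t, x), D.H w.1 w.2 p < D.H t x p + ε / 2 := by
      have h1 : Continuous fun w : ℝ × ℝ => D.H w.1 w.2 p :=
        D.contH.comp (continuous_fst.prodMk (continuous_snd.prodMk continuous_const))
      exact h1.continuousAt.eventually_lt_const (by simp only; linarith)
    obtain ⟨h, hh, hbox⟩ := exists_backward_box (hmin.and (hH'.and
      (eventually_sub_le_of_differentiableAt hd hK (half_pos hε)))) hK
    obtain ⟨y, hy, h1⟩ := hsup t x h p (D.H t x p + ε / 2) hh fun r hr y hy =>
      (hbox r hr y hy).2.1.le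
    obtain ⟨h2, -, h3⟩ := hbox (t - h) ⟨le_rfl, by linarith⟩ y hy
    have h4 := (abs_le.mp (h3 h (by simp [abs_of_pos hh]) hy)).1
    simp only at h2 h4
    have h5 : h * a ≤ h * (q + D.H t x p + ε) := by linarith
    exact le_of_mul_le_mul_left h5 hh

theorem fderiv_add_mul_fst {φ : ℝ × ℝ → ℝ} (hφ : ContDiff ℝ 1 φ) (a : ℝ) (z : ℝ × ℝ) :
    fderiv ℝ (fun w : ℝ × ℝ => φ w + a * w.1) z =
      fderiv ℝ φ z + a • ContinuousLinearMap.fst ℝ ℝ ℝ :=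
  (((hφ.differentiable one_ne_zero).differentiableAt (x := z)).hasFDerivAt.add
    (hasFDerivAt_fst.const_mul a)).fderiv

/-- Removing the right-hand side of the Hamilton–Jacobi equation by adding a linear function of
time. -/
theorem ViscSol.sub_mul {H : ℝ → ℝ → ℝ → ℝ} {c a : ℝ} {v : ℝ → ℝ → ℝ} (S : Set (ℝ × ℝ))
    (h : ViscSol H c a univ v) : ViscSol H c 0 S fun t x => v t x - a * t := by
  constructor
  · intro φ hφ z _ hz
    have h1 := h.1 (fun w => φ w + a * w.1) (hφ.add (by fun_prop)) z (mem_univ z) (by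
      refine hz.mono fun w hw => ?_
      simp only at hw ⊢
      linarith)
    rw [fderiv_add_mul_fst hφ] at h1
    simp at h1
    linarith
  · intro φ hφ z _ hz
    have h1 := h.2 (fun w => φ w + a * w.1) (hφ.add (by fun_prop)) z (mem_univ z) (by
      refine hz.mono fun w hw => ?_
      simp only at hw ⊢
      linarith)
    rw [fderiv_add_mul_fst hφ] at h1
    simp at h1
    linarith

theorem eq_alpha_of_periodic_viscSol {H : ℝ → ℝ → ℝ → ℝ} {α : ℝ → ℝ}
    (hα : ∀ c t₀ : ℝ, ∀ u : ℝ → ℝ → ℝ, IsViscSolOn H c t₀ u →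
      ∃ M, ∀ t ∈ Ici t₀, ∀ x, |u t x + t * α c| ≤ M) {c a : ℝ} {v : ℝ → ℝ → ℝ}
    (hc : Continuous (fun z : ℝ × ℝ => v z.1 z.2)) (ht : ∀ θ x, v (θ + 1) x = v θ x)
    (hx : ∀ θ x, v θ (x + 1) = v θ x) (hv : ViscSol H c a univ v) : a = α c := by
  obtain ⟨M, hM⟩ := hα c 0 (fun t x => v t x - a * t)
    ⟨(hc.sub (by fun_prop)).continuousOn, fun t x => by simp only [hx], hv.sub_mul _⟩
  obtain ⟨C, hC0, hC⟩ := exists_bound_of_periodic (f := fun t x _ => v t x)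
    (hc.comp (continuous_fst.prodMk (continuous_fst.comp continuous_snd)))
    (fun t x _ => ht t x) (fun t x _ => hx t x) 0
  have key : ∀ t : ℝ, 0 ≤ t → t * |α c - a| ≤ M + C := by
    intro t ht0
    have h1 := abs_le.mp (hM t ht0 0)
    have h2 := abs_le.mp (hC t 0 0 (by simp))
    rw [← abs_of_nonneg ht0, ← abs_mul, abs_le]
    constructor <;> linarith [h1.1, h1.2, h2.1, h2.2]
  by_contra hne
  have hpos : 0 < |α c - a| := abs_pos.2 (sub_ne_zero.2 (Ne.symm hne))
  have h0 : 0 ≤ M + C := by simpa using key 0 le_rfl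
  have := key ((M + C + 1) / |α c - a|) (by positivity)
  rw [div_mul_cancel₀ _ hpos.ne'] at this
  linarith

/-- the Hamilton–Jacobi equation `∂_θ u + H(θ,x,c+∂_x u) = a` has a
`1`-periodic viscosity solution if and only if `a = α(c)`, where `α` is characterized by
the boundedness of `u + tα(c)` for viscosity solutions of `(HJc)`. -/
theorem stmt_9 (H : ℝ → ℝ → ℝ → ℝ) (hH : BurgersHyp H) (α : ℝ → ℝ)
    (hα : ∀ c t₀ : ℝ, ∀ u : ℝ → ℝ → ℝ, IsViscSolOn H c t₀ u →
      ∃ M, ∀ t ∈ Ici t₀, ∀ x, |u t x + t * α c| ≤ M)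
    (c a : ℝ) :
    (∃ v : ℝ → ℝ → ℝ, Continuous (fun z : ℝ × ℝ => v z.1 z.2) ∧
      (∀ θ x, v (θ + 1) x = v θ x) ∧ (∀ θ x, v θ (x + 1) = v θ x) ∧
      ViscSol H c a univ v) ↔ a = α c := by
  constructor
  · rintro ⟨v, hc, ht, hx, hv⟩
    exact eq_alpha_of_periodic_viscSol hα hc ht hx hv
  · rintro rfl
    obtain ⟨a', v, hc, ht, hx, hv⟩ := hH.exists_periodic_viscSol c
    obtain rfl := eq_alpha_of_periodic_viscSol hα hc ht hx hv
    exact ⟨v, hc, ht, hx, hv⟩
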